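/- arXiv:math/0505469 — 2 statements merged into one kernel-verified Lean document; each statement's English description precedes it below -/
import Mathlib

section
/- Let D = {(t,z) ∈ ℂ × ℂ^n : ρ(t,z) < 0} where ρ is smooth and strictly plurisubharmonic near the closure of D and has non-vanishing gradient on ∂D. Let φ be smooth and plurisubharmonic near the closure of D. Fix z, and for t with z ∈ D_t let K_t(z,z) be the Bergman kernel of the slice D_t = {ζ : (t,ζ) ∈ D} with weight φ^t = φ(t,·), evaluated at (z,z). Then t ↦ K_t(z,z) is upper semicontinuous. -/
open MeasureTheory Filter Set Metric Complex
open scoped ENNReal NNReal Topology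

noncomputable section

namespace Berndtsson

instance (n : ℕ) : MeasurableSpace (EuclideanSpace ℂ (Fin n)) := borel _
instance (n : ℕ) : BorelSpace (EuclideanSpace ℂ (Fin n)) := ⟨rfl⟩
instance (n : ℕ) : MeasureSpace (EuclideanSpace ℂ (Fin n)) :=
  ⟨Measure.map (EuclideanSpace.equiv (Fin n) ℂ).symm volume⟩

abbrev Cn (n : ℕ) := EuclideanSpace ℂ (Fin n)

/-- A function `f`, with values in `EReal`, is plurisubharmonic on `s` if it is upper
semicontinuous on `s` and satisfies the sub-mean value inequality on every complex circle
whose corresponding closed disk is contained in `s` (formulated via continuous majorants,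
which for upper semicontinuous integrands is equivalent to the upper-integral form). -/
def PlurisubharmonicOn {E : Type*} [NormedAddCommGroup E] [NormedSpace ℂ E]
    (f : E → EReal) (s : Set E) : Prop :=
  UpperSemicontinuousOn f s ∧
    ∀ z ∈ s, ∀ w : E, ∀ r : ℝ, 0 < r →
      (∀ l : ℂ, ‖l‖ ≤ r → z + l • w ∈ s) →
      ∀ h : ℝ → ℝ, Continuous h →
        (∀ θ : ℝ, f (z + ((r : ℂ) * Complex.exp (θ * Complex.I)) • w) ≤ (h θ : EReal)) →
        f z ≤ (((2 * Real.pi)⁻¹ * ∫ θ in (0:ℝ)..(2 * Real.pi), h θ : ℝ) : EReal)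

/-- Plurisubharmonicity for real-valued functions. -/
def PshOn {E : Type*} [NormedAddCommGroup E] [NormedSpace ℂ E] (f : E → ℝ) (s : Set E) : Prop :=
  PlurisubharmonicOn (fun z => (f z : EReal)) s

/-- A pseudoconvex domain: an open set admitting a plurisubharmonic exhaustion function. -/
def Pseudoconvex {E : Type*} [NormedAddCommGroup E] [NormedSpace ℂ E] (D : Set E) : Prop :=
  IsOpen D ∧ ∃ u : E → ℝ, PshOn u D ∧ ∀ c : ℝ, IsCompact {z ∈ D | u z ≤ c}

/-- `log` with values in `EReal`, sending nonpositive reals to `⊥`. -/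
def elog (x : ℝ) : EReal := if 0 < x then ((Real.log x : ℝ) : EReal) else ⊥

/-- Membership in the weighted Bergman space `A²(Ω, e^{-φ})`. -/
def MemA2 {n : ℕ} (Ω : Set (Cn n)) (φ : Cn n → ℝ) (h : Cn n → ℂ) : Prop :=
  DifferentiableOn ℂ h Ω ∧
    IntegrableOn (fun ζ => ‖h ζ‖ ^ 2 * Real.exp (-φ ζ)) Ω volume

/-- `Kz` is the Bergman kernel of `A²(Ω, e^{-φ})` at the point `z`:
it belongs to the space and reproduces the value at `z` of every member. -/
def IsBergmanKernelAt {n : ℕ} (Ω : Set (Cn n)) (φ : Cn n → ℝ) (z : Cn n)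
    (Kz : Cn n → ℂ) : Prop :=
  MemA2 Ω φ Kz ∧
    ∀ h : Cn n → ℂ, MemA2 Ω φ h →
      ∫ ζ in Ω, h ζ * (starRingEnd ℂ) (Kz ζ) * (Real.exp (-φ ζ) : ℂ) = h z

/-- The Bergman kernel on the diagonal, via its extremal characterization
`K(z,z) = sup {|h(z)|² : h holomorphic on Ω, ∫_Ω |h|² e^{-φ} ≤ 1}`. -/
def bergmanDiag {n : ℕ} (Ω : Set (Cn n)) (φ : Cn n → ℝ) (z : Cn n) : ℝ :=
  sSup {v : ℝ | ∃ h : Cn n → ℂ, DifferentiableOn ℂ h Ω ∧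
    IntegrableOn (fun ζ => ‖h ζ‖ ^ 2 * Real.exp (-φ ζ)) Ω volume ∧
    (∫ ζ in Ω, ‖h ζ‖ ^ 2 * Real.exp (-φ ζ)) ≤ 1 ∧ v = ‖h z‖ ^ 2}

end Berndtsson

namespace Berndtsson

/-- Strict plurisubharmonicity of a (C²) function: positivity of the Levi form, expressed by
`4 ∂∂̄f(z)(w,w̄) = D²f(z)(w,w) + D²f(z)(iw,iw) > 0` for all `w ≠ 0`. -/
def StrictPlurisubharmonicOn {E : Type*} [NormedAddCommGroup E] [NormedSpace ℂ E]
    (f : E → ℝ) (s : Set E) : Prop :=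
  ∀ z ∈ s, ∀ w : E, w ≠ 0 →
    0 < iteratedFDeriv ℝ 2 f z ![w, w] +
        iteratedFDeriv ℝ 2 f z ![Complex.I • w, Complex.I • w]

theorem exists_tendsto_of_eventually_norm_le {ι V : Type*} [SeminormedAddCommGroup V]
    [ProperSpace V] {U : Ultrafilter ι} {G : ι → V} {M : ℝ}
    (hG : ∀ᶠ i in (U : Filter ι), ‖G i‖ ≤ M) : ∃ a, Tendsto G U (𝓝 a) := by
  obtain ⟨a, -, ha⟩ := (isCompact_closedBall (0 : V) M).ultrafilter_le_nhds' (U.map G)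
    (Ultrafilter.mem_map.2 (hG.mono fun i hi => by simpa using hi))
  exact ⟨a, ha⟩

section General

variable {E : Type*} [NormedAddCommGroup E] [NormedSpace ℂ E]

/-- First- and second-order Cauchy estimates for a bounded holomorphic function on a ball. -/
theorem cauchy_estimates_of_norm_le {F : E → ℂ} {x y : E} {R M : ℝ} (hR : 0 < R)
    (hd : DifferentiableOn ℂ F (ball x R)) (hM : ∀ y ∈ ball x R, ‖F y‖ ≤ M)
    (hy : y ∈ ball x R) :
    ‖fderiv ℂ F x‖ ≤ 2 * M / R ∧ dist (F y) (F x) ≤ 2 * M / R * dist y x ∧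
      ‖F y - F x - fderiv ℂ F x (y - x)‖ ≤ 4 * M * (dist y x / R) ^ 2 := by
  have hx : x ∈ ball x R := mem_ball_self hR
  have hmaps : MapsTo F (ball x R) (closedBall (F x) (2 * M)) := fun z hz => by
    rw [mem_closedBall, dist_eq_norm]
    linarith [norm_sub_le (F z) (F x), hM z hz, hM x hx]
  have hder : ‖fderiv ℂ F x‖ ≤ 2 * M / R := norm_fderiv_le_div_of_mapsTo_ball hd hmaps hR
  refine ⟨hder, dist_le_div_mul_dist_of_mapsTo_ball hd hmaps hy, ?_⟩
  have hFx : HasFDerivAt F (fderiv ℂ F x) x :=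
    (hd.differentiableAt (isOpen_ball.mem_nhds hx)).hasFDerivAt
  have hrem := dist_le_mul_div_pow_of_mapsTo_ball_of_isLittleO (n := 1) (R₂ := 4 * M)
    (f := fun z => F z - F x - fderiv ℂ F x (z - x)) (by fun_prop) ?_ ?_ hy
  · simpa [dist_eq_norm] using hrem
  · intro z hz
    have h1 : ‖fderiv ℂ F x (z - x)‖ ≤ 2 * M := by
      have hzR : ‖z - x‖ < R := by simpa [dist_eq_norm] using hz
      calc _ ≤ ‖fderiv ℂ F x‖ * ‖z - x‖ := (fderiv ℂ F x).le_opNorm _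
        _ ≤ 2 * M / R * R := by gcongr; exact (norm_nonneg _).trans hder
        _ = 2 * M := by field_simp
    have h2 : ‖F z - F x‖ ≤ 2 * M := by simpa [dist_eq_norm] using hmaps hz
    simp only [mem_closedBall, dist_eq_norm, sub_self, map_zero, sub_zero]
    linarith [norm_sub_le (F z - F x) (fderiv ℂ F x (z - x))]
  · simpa using hFx.isLittleO.norm_right

variable [FiniteDimensional ℂ E]

/-- An ultrafilter version of Montel's theorem: a locally uniformly bounded family of holomorphic
functions converges locally uniformly along any ultrafilter to a holomorphic function. -/
theorem exists_differentiableOn_tendsto_ultrafilter {ι : Type*} (U : Ultrafilter ι) {Ω : Set E}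
    (hΩ : IsOpen Ω) {F : ι → E → ℂ}
    (hF : ∀ x ∈ Ω, ∃ R > 0, ∃ M : ℝ, ∀ᶠ i in (U : Filter ι),
      DifferentiableOn ℂ (F i) (ball x R) ∧ ∀ y ∈ ball x R, ‖F i y‖ ≤ M) :
    ∃ f : E → ℂ, DifferentiableOn ℂ f Ω ∧
      ∀ x ∈ Ω, Tendsto (fun p : ι × E => F p.1 p.2) ((U : Filter ι) ×ˢ 𝓝 x) (𝓝 (f x)) := by
  have hpt : ∀ x, ∃ a, x ∈ Ω → Tendsto (fun i => F i x) U (𝓝 a) := by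
    intro x
    by_cases hx : x ∈ Ω
    · obtain ⟨R, hR, M, h⟩ := hF x hx
      obtain ⟨a, ha⟩ := exists_tendsto_of_eventually_norm_le (G := fun i => F i x) (M := M)
        (h.mono fun i hi => hi.2 x (mem_ball_self hR))
      exact ⟨a, fun _ => ha⟩
    · exact ⟨0, fun h => absurd h hx⟩
  choose f hf using hpt
  refine ⟨f, fun x hx => ?_, fun x hx => ?_⟩
  · obtain ⟨R, hR, M, h⟩ := hF x hx
    have : ProperSpace (E →L[ℂ] ℂ) := FiniteDimensional.proper ℂ _
    obtain ⟨A, hA⟩ := exists_tendsto_of_eventually_norm_le (G := fun i => fderiv ℂ (F i) x)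
      (h.mono fun i hi => (cauchy_estimates_of_norm_le hR hi.1 hi.2 (mem_ball_self hR)).1)
    refine DifferentiableAt.differentiableWithinAt (HasFDerivAt.differentiableAt (f' := A) ?_)
    refine .of_isLittleO ?_
    have hO : (fun y => f y - f x - A (y - x)) =O[𝓝 x] fun y => ‖y - x‖ ^ 2 := by
      refine Asymptotics.IsBigO.of_bound (4 * M / R ^ 2) ?_
      filter_upwards [isOpen_ball.mem_nhds (mem_ball_self hR), hΩ.mem_nhds hx] with y hy hyΩ
      have hAy : Tendsto (fun i => fderiv ℂ (F i) x (y - x)) U (𝓝 (A (y - x))) :=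
        ((ContinuousLinearMap.apply ℂ ℂ (y - x)).continuous.tendsto A).comp hA
      refine le_of_tendsto (((hf y hyΩ).sub (hf x hx)).sub hAy).norm ?_
      filter_upwards [h] with i hi
      refine (cauchy_estimates_of_norm_le hR hi.1 hi.2 hy).2.2.trans_eq ?_
      simp [dist_eq_norm]
      ring
    refine hO.trans_isLittleO ?_
    refine Asymptotics.IsLittleO.of_norm_right ?_
    have := (Asymptotics.isLittleO_pow_id (𝕜 := ℝ) (one_lt_two)).comp_tendsto
      (k := fun y : E => ‖y - x‖) (l' := 𝓝 x)
      (by simpa using (show Continuous fun y : E => ‖y - x‖ by fun_prop).tendsto x)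
    simpa [Function.comp_def] using this
  · obtain ⟨R, hR, M, h⟩ := hF x hx
    have h1 : Tendsto (fun p : ι × E => F p.1 x) ((U : Filter ι) ×ˢ 𝓝 x) (𝓝 (f x)) :=
      (hf x hx).comp tendsto_fst
    refine tendsto_iff_of_dist ?_ |>.1 h1
    have h2 : Tendsto (fun p : ι × E => 2 * M / R * dist p.2 x) ((U : Filter ι) ×ˢ 𝓝 x) (𝓝 0) := by
      have : Tendsto (fun y : E => 2 * M / R * dist y x) (𝓝 x) (𝓝 0) := by
        simpa using (show Continuous fun y : E => 2 * M / R * dist y x by fun_prop).tendsto x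
      exact this.comp tendsto_snd
    refine squeeze_zero' (Eventually.of_forall fun _ => dist_nonneg) ?_ h2
    filter_upwards [h.prod_mk (isOpen_ball.mem_nhds (mem_ball_self hR))] with p hp
    rw [dist_comm]
    exact (cauchy_estimates_of_norm_le hR hp.1.1 hp.1.2 hp.2).2.1

variable [MeasurableSpace E] [BorelSpace E] (μ : Measure E) [μ.IsAddHaarMeasure]

theorem measurePreserving_smul_of_norm_eq_one {c : ℂ} (hc : ‖c‖ = 1) :
    MeasurePreserving (fun w : E => c • w) μ μ := by
  have hc0 : c ≠ 0 := by rintro rfl; simp at hc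
  have : ProperSpace E := FiniteDimensional.proper ℂ E
  let L : E ≃L[ℂ] E := ContinuousLinearEquiv.smulLeft (Units.mk0 c hc0)
  have hL : ⇑L = fun w : E => c • w := rfl
  refine ⟨by fun_prop, ?_⟩
  rw [← hL, Measure.isAddLeftInvariant_eq_smul (μ.map L) μ]
  have hball : μ.map L (ball 0 1) = μ (ball 0 1) := by
    rw [Measure.map_apply L.continuous.measurable measurableSet_ball]
    congr 1
    ext w
    simp [hL, norm_smul, hc]
  rw [Measure.isAddLeftInvariant_eq_smul (μ.map L) μ, Measure.smul_apply] at hball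
  have h0 : μ (ball (0 : E) 1) ≠ 0 := (measure_ball_pos μ 0 one_pos).ne'
  have hs : ((Measure.addHaarScalarFactor (μ.map L) μ : ℝ≥0∞)) = 1 := by
    rw [ENNReal.smul_def, smul_eq_mul] at hball
    exact (ENNReal.mul_eq_right h0 measure_ball_lt_top.ne).1 hball
  rw [show Measure.addHaarScalarFactor (μ.map L) μ = 1 by exact_mod_cast hs, one_smul]

theorem measureReal_mul_norm_le_setIntegral {f : E → ℂ} {x : E} {r R : ℝ} (hrR : r < R)
    (hf : DifferentiableOn ℂ f (ball x R)) :
    μ.real (closedBall (0 : E) r) * ‖f x‖ ≤ ∫ y in closedBall x r, ‖f y‖ ∂μ := by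
  have : ProperSpace E := FiniteDimensional.proper ℂ E
  set B := closedBall (0 : E) r
  have hBm : MeasurableSet B := measurableSet_closedBall
  have hmem : ∀ w ∈ B, ∀ c : ℂ, ‖c‖ ≤ 1 → x + c • w ∈ ball x R := by
    intro w hw c hc
    have hw' : ‖w‖ ≤ r := by simpa [B] using hw
    simp only [mem_ball, dist_self_add_left, norm_smul]
    nlinarith [norm_nonneg w, norm_nonneg c]
  have hcont : ContinuousOn (fun p : ℝ × E => ‖f (x + circleMap 0 1 p.1 • p.2)‖)
      (uIcc 0 (2 * Real.pi) ×ˢ B) := by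
    refine (hf.continuousOn.comp (Continuous.continuousOn ?_) ?_).norm
    · exact continuous_const.add (((continuous_circleMap 0 1).comp continuous_fst).smul
        continuous_snd)
    · exact fun p hp => hmem _ hp.2 _ (by simp)
  have hpt : ∀ w ∈ B, ‖f x‖ ≤
      (2 * Real.pi)⁻¹ * ∫ θ in (0 : ℝ)..2 * Real.pi, ‖f (x + circleMap 0 1 θ • w)‖ := by
    intro w hw
    have hg : DiffContOnCl ℂ (fun c : ℂ => f (x + c • w)) (ball 0 |1|) := by
      refine DifferentiableOn.diffContOnCl ?_
      refine hf.comp (by fun_prop) fun c hc => hmem w hw c ?_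
      simpa using closure_ball_subset_closedBall hc
    have h := hg.circleAverage
    rw [Real.circleAverage_def] at h
    simp only [zero_smul, add_zero] at h
    rw [← h, norm_smul, Real.norm_of_nonneg (by positivity)]
    gcongr
    exact intervalIntegral.norm_integral_le_integral_norm (by positivity)
  have hI : ∀ θ : ℝ, ∫ w in B, ‖f (x + circleMap 0 1 θ • w)‖ ∂μ =
      ∫ y in closedBall x r, ‖f y‖ ∂μ := by
    intro θ
    have hc : ‖circleMap 0 1 θ‖ = 1 := by simp
    have hc0 : circleMap 0 1 θ ≠ 0 := by intro h; simp [h] at hc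
    have h1 := (measurePreserving_smul_of_norm_eq_one (E := E) μ hc).setIntegral_preimage_emb
      ((Homeomorph.smulOfNeZero _ hc0).measurableEmbedding) (fun w => ‖f (x + w)‖) B
    have h2 := (measurePreserving_add_left μ x).setIntegral_preimage_emb
      (measurableEmbedding_addLeft x) (fun w => ‖f w‖) (closedBall x r)
    have e1 : (fun w : E => circleMap 0 1 θ • w) ⁻¹' B = B := by
      ext w; simp [B, norm_smul]
    have e2 : (fun w : E => x + w) ⁻¹' closedBall x r = B := by
      ext w; simp [B]
    rw [e1] at h1
    rw [e2] at h2
    exact h1.trans h2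
  have hint : Integrable (fun p : ℝ × E => ‖f (x + circleMap 0 1 p.1 • p.2)‖)
      ((volume.restrict (uIoc 0 (2 * Real.pi))).prod (μ.restrict B)) := by
    rw [Measure.prod_restrict]
    exact (hcont.integrableOn_compact (isCompact_uIcc.prod (isCompact_closedBall _ _))).mono_set
      (prod_mono uIoc_subset_uIcc subset_rfl)
  have hB : μ B ≠ ∞ := measure_closedBall_lt_top.ne
  calc μ.real B * ‖f x‖ = ∫ w in B, ‖f x‖ ∂μ := by simp
    _ ≤ ∫ w in B, (2 * Real.pi)⁻¹ *
          (∫ θ in (0 : ℝ)..2 * Real.pi, ‖f (x + circleMap 0 1 θ • w)‖) ∂μ := by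
        refine setIntegral_mono_on (integrableOn_const hB) ?_ hBm hpt
        refine Integrable.const_mul ?_ _
        simp_rw [intervalIntegral.integral_of_le Real.two_pi_pos.le,
          ← uIoc_of_le Real.two_pi_pos.le]
        exact hint.integral_prod_right
    _ = (2 * Real.pi)⁻¹ * ∫ θ in (0 : ℝ)..2 * Real.pi,
          ∫ w in B, ‖f (x + circleMap 0 1 θ • w)‖ ∂μ := by
        rw [integral_const_mul, intervalIntegral_integral_swap hint]
    _ = ∫ y in closedBall x r, ‖f y‖ ∂μ := by
        simp_rw [hI]
        rw [intervalIntegral.integral_const, smul_eq_mul]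
        field_simp
        ring

/-- Pointwise control of a holomorphic function by its weighted `L²` norm. -/
theorem sq_norm_le_of_setIntegral_le {Ω : Set E} {h : E → ℂ}
    {w : E → ℝ} {x y : E} {R m C : ℝ} (hm : 0 < m) (hsub : ball x R ⊆ Ω)
    (hw0 : ∀ y, 0 ≤ w y) (hw : ∀ y ∈ ball x R, m ≤ w y) (hd : DifferentiableOn ℂ h Ω)
    (hint : IntegrableOn (fun y => ‖h y‖ ^ 2 * w y) Ω μ)
    (hC : ∫ y in Ω, ‖h y‖ ^ 2 * w y ∂μ ≤ C) (hy : y ∈ ball x (R / 2)) :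
    ‖h y‖ ^ 2 ≤ C / (m * μ.real (closedBall (0 : E) (R / 4))) := by
  have : ProperSpace E := FiniteDimensional.proper ℂ E
  have hR : 0 < R := by linarith [pos_of_mem_ball hy]
  have hyR : ball y (R / 2) ⊆ ball x R := ball_subset_ball' (by rw [mem_ball] at hy; linarith)
  have hcl : closedBall y (R / 4) ⊆ ball x R :=
    (closedBall_subset_ball (by linarith)).trans hyR
  have hV : 0 < μ.real (closedBall (0 : E) (R / 4)) :=
    ENNReal.toReal_pos (measure_closedBall_pos μ 0 (by positivity)).ne'
      measure_closedBall_lt_top.ne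
  have hdR := hd.mono hsub
  have hmean := measureReal_mul_norm_le_setIntegral μ (f := fun y => h y ^ 2) (x := y)
    (show R / 4 < R / 2 by linarith) ((hdR.mono hyR).pow 2)
  simp only [norm_pow] at hmean
  have hi : IntegrableOn (fun y => ‖h y‖ ^ 2) (closedBall y (R / 4)) μ :=
    (((hdR.mono hcl).continuousOn.norm).pow 2).integrableOn_compact (isCompact_closedBall _ _)
  rw [le_div_iff₀ (by positivity)]
  calc ‖h y‖ ^ 2 * (m * μ.real (closedBall (0 : E) (R / 4)))
      = m * (μ.real (closedBall (0 : E) (R / 4)) * ‖h y‖ ^ 2) := by ring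
    _ ≤ m * ∫ z in closedBall y (R / 4), ‖h z‖ ^ 2 ∂μ := by gcongr
    _ = ∫ z in closedBall y (R / 4), m * ‖h z‖ ^ 2 ∂μ := (integral_const_mul _ _).symm
    _ ≤ ∫ z in closedBall y (R / 4), ‖h z‖ ^ 2 * w z ∂μ := by
        refine setIntegral_mono_on (hi.const_mul m) (hint.mono_set (hcl.trans hsub))
          measurableSet_closedBall fun z hz => ?_
        rw [mul_comm]
        gcongr
        exact hw z (hcl hz)
    _ ≤ ∫ z in Ω, ‖h z‖ ^ 2 * w z ∂μ := by
        refine setIntegral_mono_set hint (ae_of_all _ fun z => ?_)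
          (hcl.trans hsub).eventuallyLE
        have := hw0 z
        simp only [Pi.zero_apply]
        positivity
    _ ≤ C := hC

end General

/-- A version of Fatou's lemma along an arbitrary filter, for locally uniform convergence. -/
theorem integrableOn_and_setIntegral_le_of_tendsto {X ι : Type*} [MetricSpace X] [ProperSpace X]
    [MeasurableSpace X] [BorelSpace X] (μ : Measure X) [IsFiniteMeasureOnCompacts μ]
    {l : Filter ι} [l.NeBot] {Ω : Set X} (hΩ : IsOpen Ω) {G : ι → X → ℝ} {g : X → ℝ} {C : ℝ}
    (hg0 : ∀ x, 0 ≤ g x) (hg : ContinuousOn g Ω)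
    (hG : ∀ x ∈ Ω, Tendsto (fun p : ι × X => G p.1 p.2) (l ×ˢ 𝓝 x) (𝓝 (g x)))
    (hC : ∀ K ⊆ Ω, IsCompact K → ∀ᶠ i in l, IntegrableOn (G i) K μ ∧ ∫ x in K, G i x ∂μ ≤ C) :
    IntegrableOn g Ω μ ∧ ∫ x in Ω, g x ∂μ ≤ C := by
  have hloc : TendstoLocallyUniformlyOn G g l Ω := by
    rw [hΩ.tendstoLocallyUniformlyOn_iff_forall_tendsto]
    intro x hx
    have h1 : Tendsto (fun p : ι × X => g p.2) (l ×ˢ 𝓝 x) (𝓝 (g x)) :=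
      (hg.continuousAt (hΩ.mem_nhds hx)).tendsto.comp tendsto_snd
    have h2 := h1.prodMk (hG x hx)
    rw [← nhds_prod_eq] at h2
    exact h2.mono_right (nhds_le_uniformity _)
  have hK : ∀ K ⊆ Ω, IsCompact K → IntegrableOn g K μ ∧ ∫ x in K, g x ∂μ ≤ C := by
    intro K hKΩ hK
    have hgK : IntegrableOn g K μ := (hg.mono hKΩ).integrableOn_compact hK
    refine ⟨hgK, ?_⟩
    have hunif := (tendstoLocallyUniformlyOn_iff_tendstoUniformlyOn_of_compact hK).1
      (hloc.mono hKΩ)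
    have hε : ∀ ε > 0, ∫ x in K, g x ∂μ ≤ C + ε * μ.real K := by
      intro ε hε
      obtain ⟨i, hi, hGi, hCi⟩ :=
        ((Metric.tendstoUniformlyOn_iff.1 hunif ε hε).and (hC K hKΩ hK)).exists
      have hconst : IntegrableOn (fun _ : X => ε) K μ := integrableOn_const hK.measure_lt_top.ne
      calc ∫ x in K, g x ∂μ ≤ ∫ x in K, (G i x + ε) ∂μ := by
            refine setIntegral_mono_on hgK (hGi.add hconst) hK.measurableSet fun x hx => ?_
            have := hi x hx
            rw [Real.dist_eq] at this
            linarith [(abs_lt.1 this).2]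
        _ = ∫ x in K, G i x ∂μ + ε * μ.real K := by
            rw [integral_add hGi hconst]
            simp [mul_comm]
        _ ≤ C + ε * μ.real K := by gcongr
    have hlim : Tendsto (fun ε : ℝ => C + ε * μ.real K) (𝓝[>] 0) (𝓝 C) := by
      have : Continuous fun ε : ℝ => C + ε * μ.real K := by fun_prop
      simpa using (this.tendsto 0).mono_left nhdsWithin_le_nhds
    exact ge_of_tendsto hlim (eventually_mem_nhdsWithin.mono hε)
  obtain ⟨F, hFc, hFΩ, hFU, hFm⟩ := hΩ.exists_iUnion_isClosed
  rcases Ω.eq_empty_or_nonempty with rfl | ⟨x₀, -⟩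
  · simpa using (hK ∅ subset_rfl isCompact_empty).2
  set S : ℕ → Set X := fun n => F n ∩ closedBall x₀ n
  have hSc : ∀ n, IsCompact (S n) := fun n => (isCompact_closedBall _ _).inter_left (hFc n)
  have hSΩ : ∀ n, S n ⊆ Ω := fun n => inter_subset_left.trans (hFΩ n)
  have hcover : AECover (μ.restrict Ω) atTop S := by
    refine ⟨?_, fun n => (hSc n).measurableSet⟩
    refine ae_restrict_of_forall_mem hΩ.measurableSet fun x hx => ?_
    rw [← hFU] at hx
    obtain ⟨n, hn⟩ := mem_iUnion.1 hx
    filter_upwards [eventually_ge_atTop n,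
      tendsto_natCast_atTop_atTop.eventually_ge_atTop (dist x x₀)] with k hk hk'
    exact ⟨hFm hk hn, hk'⟩
  have hres : ∀ n, (μ.restrict Ω).restrict (S n) = μ.restrict (S n) := fun n =>
    Measure.restrict_restrict_of_subset (hSΩ n)
  have hgΩ : IntegrableOn g Ω μ := by
    refine hcover.integrable_of_integral_bounded_of_nonneg_ae C (fun n => ?_)
      (ae_of_all _ hg0) (Eventually.of_forall fun n => ?_)
    · rw [IntegrableOn, hres]
      exact (hK _ (hSΩ n) (hSc n)).1
    · rw [hres]
      exact (hK _ (hSΩ n) (hSc n)).2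
  refine ⟨hgΩ, le_of_tendsto (hcover.integral_tendsto_of_countably_generated hgΩ)
    (Eventually.of_forall fun n => ?_)⟩
  rw [hres]
  exact (hK _ (hSΩ n) (hSc n)).2

instance (n : ℕ) : (volume : Measure (Cn n)).IsAddHaarMeasure :=
  inferInstanceAs (Measure.map (EuclideanSpace.equiv (Fin n) ℂ).symm volume).IsAddHaarMeasure

/-- Competitors in the extremal problem defining `bergmanDiag`. -/
def IsBergmanCompetitor {n : ℕ} (Ω : Set (Cn n)) (φ : Cn n → ℝ) (h : Cn n → ℂ) : Prop :=
  DifferentiableOn ℂ h Ω ∧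
    IntegrableOn (fun ζ => ‖h ζ‖ ^ 2 * Real.exp (-φ ζ)) Ω volume ∧
    (∫ ζ in Ω, ‖h ζ‖ ^ 2 * Real.exp (-φ ζ)) ≤ 1

theorem bergmanDiag_eq {n : ℕ} (Ω : Set (Cn n)) (φ : Cn n → ℝ) (z : Cn n) :
    bergmanDiag Ω φ z = sSup {v : ℝ | ∃ h, IsBergmanCompetitor Ω φ h ∧ v = ‖h z‖ ^ 2} := by
  simp only [bergmanDiag, IsBergmanCompetitor, and_assoc]

/-- Locally uniform bound for the competitors on all slices near a given one. -/
theorem exists_norm_le_of_isBergmanCompetitor {n : ℕ} {D : Set (ℂ × Cn n)} (hD : IsOpen D)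
    {φ : ℂ × Cn n → ℝ} (hφ : ContinuousOn φ D) {t₀ : ℂ} {x : Cn n} (hx : (t₀, x) ∈ D) :
    ∃ R > 0, ∃ M : ℝ, ∀ᶠ t in 𝓝 t₀, ball x R ⊆ {ζ | (t, ζ) ∈ D} ∧
      ∀ h, IsBergmanCompetitor {ζ | (t, ζ) ∈ D} (fun ζ => φ (t, ζ)) h →
        ∀ y ∈ ball x R, ‖h y‖ ≤ M := by
  have hnhds : ∀ᶠ p in 𝓝 t₀ ×ˢ 𝓝 x, p ∈ D ∧ φ p < φ (t₀, x) + 1 := by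
    rw [← nhds_prod_eq]
    exact (hD.eventually_mem hx).and
      ((hφ.continuousAt (hD.mem_nhds hx)).eventually_lt continuousAt_const (lt_add_one _))
  obtain ⟨T, hT, V, hV, hTV⟩ := eventually_prod_iff.1 hnhds
  obtain ⟨R, hR, hRV⟩ := Metric.mem_nhds_iff.1 hV
  set m := Real.exp (-(φ (t₀, x) + 1))
  set B := 1 / (m * (volume : Measure (Cn n)).real (closedBall 0 (R / 4)))
  refine ⟨R / 2, half_pos hR, √B, hT.mono fun t ht => ?_⟩
  have hsub : ball x R ⊆ {ζ | (t, ζ) ∈ D} := fun y hy => (hTV ht (hRV hy)).1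
  refine ⟨(ball_subset_ball (by linarith)).trans hsub, fun h hh y hy => ?_⟩
  refine Real.le_sqrt_of_sq_le ?_
  exact sq_norm_le_of_setIntegral_le volume (Real.exp_pos _) hsub (fun _ => (Real.exp_pos _).le)
    (fun y hy => Real.exp_le_exp.2 (neg_le_neg (hTV ht (hRV hy)).2.le)) hh.1 hh.2.1 hh.2.2 hy

theorem bddAbove_isBergmanCompetitor {n : ℕ} {D : Set (ℂ × Cn n)} (hD : IsOpen D)
    {φ : ℂ × Cn n → ℝ} (hφ : ContinuousOn φ D) {t : ℂ} {z : Cn n} (hz : (t, z) ∈ D) :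
    BddAbove {v : ℝ | ∃ h, IsBergmanCompetitor {ζ | (t, ζ) ∈ D} (fun ζ => φ (t, ζ)) h ∧
      v = ‖h z‖ ^ 2} := by
  obtain ⟨R, hR, M, hM⟩ := exists_norm_le_of_isBergmanCompetitor hD hφ hz
  refine ⟨M ^ 2, ?_⟩
  rintro v ⟨h, hh, rfl⟩
  have := hM.self_of_nhds.2 h hh z (mem_ball_self hR)
  gcongr

/-- Competitors on nearby slices accumulate, along an ultrafilter, to a competitor. -/
theorem exists_isBergmanCompetitor_tendsto {n : ℕ} {D : Set (ℂ × Cn n)} (hD : IsOpen D)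
    {φ : ℂ × Cn n → ℝ} (hφ : ContinuousOn φ D) {t₀ : ℂ} {U : Ultrafilter ℂ}
    (hU : (U : Filter ℂ) ≤ 𝓝 t₀) {F : ℂ → Cn n → ℂ}
    (hF : ∀ᶠ t in (U : Filter ℂ),
      IsBergmanCompetitor {ζ | (t, ζ) ∈ D} (fun ζ => φ (t, ζ)) (F t)) :
    ∃ f, IsBergmanCompetitor {ζ | (t₀, ζ) ∈ D} (fun ζ => φ (t₀, ζ)) f ∧
      ∀ x, (t₀, x) ∈ D → Tendsto (fun t => F t x) U (𝓝 (f x)) := by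
  have hΩ : IsOpen {ζ | (t₀, ζ) ∈ D} := hD.preimage (by fun_prop)
  have hslice : ∀ x, (t₀, x) ∈ D → ∃ R > 0, ∃ M : ℝ, ∀ᶠ t in (U : Filter ℂ),
      ball x R ⊆ {ζ | (t, ζ) ∈ D} ∧ ∀ y ∈ ball x R, ‖F t y‖ ≤ M := by
    intro x hx
    obtain ⟨R, hR, M, hM⟩ := exists_norm_le_of_isBergmanCompetitor hD hφ hx
    refine ⟨R, hR, M, ?_⟩
    filter_upwards [hU hM, hF] with t ht hFt using ⟨ht.1, ht.2 _ hFt⟩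
  obtain ⟨f, hfd, hf⟩ := exists_differentiableOn_tendsto_ultrafilter U hΩ (F := F) (by
    intro x hx
    obtain ⟨R, hR, M, hM⟩ := hslice x hx
    refine ⟨R, hR, M, ?_⟩
    filter_upwards [hM, hF] with t ht hFt using ⟨hFt.1.mono ht.1, ht.2⟩)
  have hφt : ContinuousOn (fun ζ => φ (t₀, ζ)) {ζ | (t₀, ζ) ∈ D} :=
    hφ.comp (by fun_prop) fun ζ hζ => hζ
  have hint := integrableOn_and_setIntegral_le_of_tendsto (volume : Measure (Cn n))
    (l := (U : Filter ℂ)) hΩ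
    (G := fun t ζ => ‖F t ζ‖ ^ 2 * Real.exp (-φ (t, ζ)))
    (g := fun ζ => ‖f ζ‖ ^ 2 * Real.exp (-φ (t₀, ζ))) (C := 1)
    (fun _ => by positivity) ((hfd.continuousOn.norm.pow 2).mul hφt.neg.rexp) ?_ ?_
  · exact ⟨f, ⟨hfd, hint⟩, fun x hx => (hf x hx).comp (tendsto_id.prodMk tendsto_const_nhds)⟩
  · intro x hx
    have hφx : Tendsto φ ((U : Filter ℂ) ×ˢ 𝓝 x) (𝓝 (φ (t₀, x))) := by
      refine (hφ.continuousAt (hD.mem_nhds hx)).tendsto.mono_left ?_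
      rw [nhds_prod_eq]
      exact prod_mono_left _ hU
    exact ((hf x hx).norm.pow 2).mul hφx.neg.rexp
  · intro K hKΩ hK
    have hKD : ∀ᶠ t in (U : Filter ℂ), K ⊆ {ζ | (t, ζ) ∈ D} := by
      refine hU ?_
      exact hK.eventually_forall_of_forall_eventually fun x hx =>
        hD.mem_nhds (hKΩ hx)
    filter_upwards [hKD, hF] with t ht hFt
    refine ⟨hFt.2.1.mono_set ht, le_trans ?_ hFt.2.2⟩
    exact setIntegral_mono_set hFt.2.1
      (ae_of_all _ fun _ => by simp only [Pi.zero_apply]; positivity) ht.eventuallyLE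

/-- The Bergman kernel on the diagonal depends upper semicontinuously on the slice as soon as
the total space is open and the weight is continuous. -/
theorem upperSemicontinuousOn_bergmanDiag {n : ℕ} {D : Set (ℂ × Cn n)} (hD : IsOpen D)
    {φ : ℂ × Cn n → ℝ} (hφ : ContinuousOn φ D) (z : Cn n) :
    UpperSemicontinuousOn
      (fun t : ℂ => bergmanDiag {ζ : Cn n | (t, ζ) ∈ D} (fun ζ => φ (t, ζ)) z)
      {t : ℂ | (t, z) ∈ D} := by
  intro t₀ ht₀ c hc
  obtain ⟨b, hb, hbc⟩ := exists_between hc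
  by_contra hne
  rw [not_eventually, frequently_iff_neBot] at hne
  obtain ⟨U, hU⟩ := Ultrafilter.exists_le (h := hne)
  have hex : ∀ t, ∃ h : Cn n → ℂ,
      ¬ bergmanDiag {ζ : Cn n | (t, ζ) ∈ D} (fun ζ => φ (t, ζ)) z < c →
      IsBergmanCompetitor {ζ : Cn n | (t, ζ) ∈ D} (fun ζ => φ (t, ζ)) h ∧ b < ‖h z‖ ^ 2 := by
    intro t
    by_cases ht : bergmanDiag {ζ : Cn n | (t, ζ) ∈ D} (fun ζ => φ (t, ζ)) z < c
    · exact ⟨0, fun h => absurd ht h⟩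
    · have hlt := hbc.trans_le (not_lt.1 ht)
      rw [bergmanDiag_eq] at hlt
      obtain ⟨_, ⟨h, hh, rfl⟩, hbh⟩ := exists_lt_of_lt_csSup
        (by exact ⟨0, 0, ⟨differentiableOn_const 0, by simp, by simp⟩, by simp⟩) hlt
      exact ⟨h, fun _ => ⟨hh, hbh⟩⟩
  choose F hF using hex
  have hFU : ∀ᶠ t in (U : Filter ℂ),
      IsBergmanCompetitor {ζ : Cn n | (t, ζ) ∈ D} (fun ζ => φ (t, ζ)) (F t) ∧
        b < ‖F t z‖ ^ 2 := by
    have : ∀ᶠ t in (U : Filter ℂ),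
        ¬ bergmanDiag {ζ : Cn n | (t, ζ) ∈ D} (fun ζ => φ (t, ζ)) z < c :=
      hU (mem_inf_of_right (mem_principal_self _))
    exact this.mono hF
  obtain ⟨f, hfc, hf⟩ := exists_isBergmanCompetitor_tendsto hD hφ
    (hU.trans (inf_le_left.trans nhdsWithin_le_nhds)) (hFU.mono fun _ h => h.1)
  have hbf : b ≤ ‖f z‖ ^ 2 := ge_of_tendsto ((hf z ht₀).norm.pow 2) (hFU.mono fun _ h => h.2.le)
  refine (hb.trans_le hbf).not_ge ?_
  simp only [bergmanDiag_eq]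
  exact le_csSup (bddAbove_isBergmanCompetitor hD hφ ht₀) ⟨f, hfc, rfl⟩

/-- **Lemma 4.5.**  Let `D = {(t,z) : ρ(t,z) < 0} ⊆ ℂ × ℂⁿ` with `ρ` smooth and strictly
plurisubharmonic near the closure of `D` and with non-vanishing gradient on `∂D`, and let
`φ` be smooth and plurisubharmonic near the closure of `D`.  Then for fixed `z`, the
Bergman kernel `K_t(z,z)` of the slice `D_t` with weight `φ^t` is upper semicontinuous
in `t` (on the set of `t` with `z ∈ D_t`). -/
theorem bergman_diag_upper_semicontinuous (n : ℕ) (D : Set (ℂ × Cn n))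
    (ρ : ℂ × Cn n → ℝ) (W : Set (ℂ × Cn n)) (hW : IsOpen W) (hDW : closure D ⊆ W)
    (hρ : ContDiffOn ℝ (⊤ : ℕ∞) ρ W) (hρspsh : StrictPlurisubharmonicOn ρ W)
    (hD : D = {p | ρ p < 0})
    (hgrad : ∀ p ∈ frontier D, fderiv ℝ ρ p ≠ 0)
    (φ : ℂ × Cn n → ℝ) (W' : Set (ℂ × Cn n)) (hW' : IsOpen W') (hDW' : closure D ⊆ W')
    (hφ : ContDiffOn ℝ (⊤ : ℕ∞) φ W') (hφpsh : PshOn φ W')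
    (z : Cn n) :
    UpperSemicontinuousOn
      (fun t : ℂ => bergmanDiag {ζ : Cn n | (t, ζ) ∈ D} (fun ζ => φ (t, ζ)) z)
      {t : ℂ | (t, z) ∈ D} := by
  have hDopen : IsOpen D := by
    have hDeq : D = W ∩ ρ ⁻¹' Iio 0 := by
      ext p
      refine ⟨fun hp => ⟨hDW (subset_closure hp), ?_⟩, fun hp => ?_⟩
      · rw [hD] at hp
        exact hp
      · rw [hD]
        exact hp.2
    rw [hDeq]
    exact hρ.continuousOn.isOpen_inter_preimage hW isOpen_Iio
  exact upperSemicontinuousOn_bergmanDiag hDopen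
    (hφ.continuousOn.mono (subset_closure.trans hDW')) z

end Berndtsson
end
end

section
/- Let Ω be a smoothly bounded convex domain in ℝ^n (n ≥ 3), and write the Green function of Ω as G(x,ξ) = −c_n/|x−ξ|^{n−2} + ψ(x,ξ), where ψ(x,·) is harmonic. Let Λ(x) = ψ(x,x) be the Robin function of Ω. Then Λ is strictly convex on Ω. -/
open MeasureTheory Filter Set
open scoped ENNReal NNReal Topology

noncomputable section

namespace Berndtsson

abbrev Rn (n : ℕ) := EuclideanSpace ℝ (Fin n)

/-- The Laplacian of a function on `ℝⁿ`. -/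
def laplacianR {n : ℕ} (w : Rn n → ℝ) (x : Rn n) : ℝ :=
  ∑ i, iteratedFDeriv ℝ 2 w x ![EuclideanSpace.single i 1, EuclideanSpace.single i 1]

/-- `G` is the Green function of `Ω ⊆ ℝⁿ` with pole at `x`. -/
def IsGreenFunctionR {n : ℕ} (Ω : Set (Rn n)) (x : Rn n) (G : Rn n → ℝ) : Prop :=
  ContinuousOn G (closure Ω \ {x}) ∧ (∀ ξ ∈ frontier Ω, G ξ = 0) ∧
    ∀ w : Rn n → ℝ, ContDiff ℝ (⊤ : ℕ∞) w → HasCompactSupport w → tsupport w ⊆ Ω →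
      (∫ ξ in Ω, G ξ * laplacianR w ξ) = w x

/-- `f` is twice differentiable at `0`, with first derivative `a` and second derivative `b`. -/
def HasD2 (f : ℝ → ℝ) (a b : ℝ) : Prop :=
  ∃ f' : ℝ → ℝ, (∀ᶠ s in 𝓝 0, HasDerivAt f (f' s) s) ∧ f' 0 = a ∧ HasDerivAt f' b 0

namespace HasD2

variable {f g : ℝ → ℝ} {a b a' b' : ℝ}

lemma add (hf : HasD2 f a b) (hg : HasD2 g a' b') :
    HasD2 (fun s => f s + g s) (a + a') (b + b') := by
  obtain ⟨f', hf1, hf2, hf3⟩ := hf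
  obtain ⟨g', hg1, hg2, hg3⟩ := hg
  refine ⟨fun s => f' s + g' s, ?_, by simp [hf2, hg2], hf3.add hg3⟩
  filter_upwards [hf1, hg1] with s h1 h2 using h1.add h2

lemma const_mul (c : ℝ) (hf : HasD2 f a b) : HasD2 (fun s => c * f s) (c * a) (c * b) := by
  obtain ⟨f', hf1, hf2, hf3⟩ := hf
  refine ⟨fun s => c * f' s, ?_, by simp [hf2], hf3.const_mul c⟩
  filter_upwards [hf1] with s h1 using h1.const_mul c

lemma const (c : ℝ) : HasD2 (fun _ => c) 0 0 :=
  ⟨fun _ => 0, Eventually.of_forall fun s => hasDerivAt_const s c, rfl, hasDerivAt_const _ _⟩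

lemma congr (hf : HasD2 f a b) (h : g =ᶠ[𝓝 0] f) : HasD2 g a b := by
  obtain ⟨f', hf1, hf2, hf3⟩ := hf
  refine ⟨f', ?_, hf2, hf3⟩
  filter_upwards [hf1, h.eventuallyEq_nhds] with s h1 h2 using h1.congr_of_eventuallyEq h2

lemma continuousAt (hf : HasD2 f a b) : ContinuousAt f 0 := by
  obtain ⟨f', hf1, -, -⟩ := hf
  exact hf1.self_of_nhds.continuousAt

lemma comp_mul (hf : HasD2 f a b) (c : ℝ) :
    HasD2 (fun s => f (c * s)) (c * a) (c ^ 2 * b) := by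
  obtain ⟨f', hf1, hf2, hf3⟩ := hf
  have ht : Tendsto (fun s : ℝ => c * s) (𝓝 0) (𝓝 0) := by
    have : ContinuousAt (fun s : ℝ => c * s) 0 := by fun_prop
    simpa [ContinuousAt] using this
  have hl : ∀ s : ℝ, HasDerivAt (fun s : ℝ => c * s) c s := fun s => by
    simpa using (hasDerivAt_id s).const_mul c
  refine ⟨fun s => c * f' (c * s), ?_, by simp [hf2], ?_⟩
  · filter_upwards [ht.eventually hf1] with s h1
    have := h1.comp s (hl s)
    rwa [mul_comm] at this
  · have h3 : HasDerivAt f' b (c * 0) := by simpa using hf3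
    exact ((h3.comp 0 (hl 0)).const_mul c).congr_deriv (by ring)

lemma comp (hf : HasD2 f a b) {G G' : ℝ → ℝ} {G'' : ℝ}
    (h1 : ∀ᶠ y in 𝓝 (f 0), HasDerivAt G (G' y) y) (h2 : HasDerivAt G' G'' (f 0)) :
    HasD2 (fun s => G (f s)) (G' (f 0) * a) (G'' * a ^ 2 + G' (f 0) * b) := by
  have hc := hf.continuousAt
  obtain ⟨f', hf1, hf2, hf3⟩ := hf
  refine ⟨fun s => G' (f s) * f' s, ?_, by simp [hf2], ?_⟩
  · filter_upwards [hf1, hc.eventually h1] with s h3 h4 using h4.comp s h3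
  · exact ((h2.comp 0 hf1.self_of_nhds).mul hf3).congr_deriv (by
      simp only [Function.comp, hf2]; ring)

lemma inv_pow (hf : HasD2 f a b) (h0 : f 0 ≠ 0) (m : ℕ) :
    HasD2 (fun s => (f s ^ m)⁻¹) (-(m : ℝ) * a / f 0 ^ (m + 1))
      (m * (m + 1) * a ^ 2 / f 0 ^ (m + 2) - m * b / f 0 ^ (m + 1)) := by
  have key : ∀ (k : ℕ) (y : ℝ), y ≠ 0 →
      HasDerivAt (fun y : ℝ => (y ^ k)⁻¹) (-(k : ℝ) * (y ^ (k + 1))⁻¹) y := by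
    intro k y hy
    refine ((hasDerivAt_pow k y).inv (pow_ne_zero k hy)).congr_deriv ?_
    rcases k with _ | k
    · simp
    · simp only [Nat.add_sub_cancel]
      field_simp
      ring
  have := hf.comp (G := fun y => (y ^ m)⁻¹) (G' := fun y => -(m : ℝ) * (y ^ (m + 1))⁻¹)
    (G'' := -(m : ℝ) * (-((m + 1 : ℕ) : ℝ) * (f 0 ^ (m + 2))⁻¹))
    ((isOpen_ne.eventually_mem h0).mono fun y hy => key m y hy)
    ((key (m + 1) _ h0).const_mul _)
  convert this using 1
  · field_simp
  · push_cast
    field_simp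
    ring

/-- The second derivative test. -/
lemma of_min (hf : HasD2 f a b) (h : ∀ᶠ s in 𝓝 0, f 0 ≤ f s) : a = 0 ∧ 0 ≤ b := by
  have hc := hf.continuousAt
  obtain ⟨f', hf1, hf2, hf3⟩ := hf
  have ha : a = 0 := by
    rw [← hf2]
    exact IsLocalMin.hasDerivAt_eq_zero h hf1.self_of_nhds
  refine ⟨ha, ?_⟩
  by_contra! hb
  have hder : deriv f =ᶠ[𝓝 0] f' := by
    filter_upwards [hf1] with s hs using hs.deriv
  have hdd : deriv (deriv f) 0 = b := (hf3.congr_of_eventuallyEq hder).deriv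
  have hmax : IsLocalMax f 0 :=
    isLocalMax_of_deriv_deriv_neg (by rw [hdd]; exact hb)
      (by rw [hder.eq_of_nhds, hf2, ha]) hc
  have hconst : f =ᶠ[𝓝 0] fun _ => f 0 := by
    filter_upwards [h, hmax] with s h1 h2 using le_antisymm h2 h1
  have h0 : deriv f =ᶠ[𝓝 0] fun _ => 0 := by
    filter_upwards [hconst.eventuallyEq_nhds] with s hs
    rw [hs.deriv_eq]
    simp
  have : deriv (deriv f) 0 = 0 := by
    rw [h0.deriv_eq]
    simp
  linarith

end HasD2

/-- `f` is twice differentiable at `x` along the coordinate axes, and the pure second derivatives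
add up to `L`. -/
def HasLap {n : ℕ} (f : Rn n → ℝ) (x : Rn n) (L : ℝ) : Prop :=
  ∃ d d2 : Fin n → ℝ,
    (∀ i, HasD2 (fun s => f (x + s • EuclideanSpace.single i (1 : ℝ))) (d i) (d2 i)) ∧
      ∑ i, d2 i = L

lemma tendsto_add_smul {n : ℕ} (x v : Rn n) :
    Tendsto (fun s : ℝ => x + s • v) (𝓝 0) (𝓝 x) := by
  have : ContinuousAt (fun s : ℝ => x + s • v) 0 := by fun_prop
  simpa [ContinuousAt] using this

namespace HasLap

variable {n : ℕ} {f g : Rn n → ℝ} {x : Rn n} {L L' : ℝ}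

lemma add (hf : HasLap f x L) (hg : HasLap g x L') :
    HasLap (fun y => f y + g y) x (L + L') := by
  obtain ⟨d, d2, h1, h2⟩ := hf
  obtain ⟨e, e2, h3, h4⟩ := hg
  exact ⟨_, _, fun i => (h1 i).add (h3 i), by rw [Finset.sum_add_distrib, h2, h4]⟩

lemma const_mul (c : ℝ) (hf : HasLap f x L) : HasLap (fun y => c * f y) x (c * L) := by
  obtain ⟨d, d2, h1, h2⟩ := hf
  exact ⟨_, _, fun i => (h1 i).const_mul c, by rw [← Finset.mul_sum, h2]⟩

lemma const (c : ℝ) : HasLap (fun _ : Rn n => c) x 0 :=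
  ⟨_, _, fun _ => HasD2.const c, by simp⟩

lemma congr (hf : HasLap f x L) (h : g =ᶠ[𝓝 x] f) : HasLap g x L := by
  obtain ⟨d, d2, h1, h2⟩ := hf
  refine ⟨d, d2, fun i => (h1 i).congr ?_, h2⟩
  exact (tendsto_add_smul x _).eventually h

lemma comp_smul {t : ℝ} (hf : HasLap f (t • x) L) : HasLap (fun y => f (t • y)) x (t ^ 2 * L) := by
  obtain ⟨d, d2, h1, h2⟩ := hf
  refine ⟨_, _, fun i => ((h1 i).comp_mul t).congr (Eventually.of_forall fun s => ?_),
    by rw [← Finset.mul_sum, h2]⟩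
  simp [smul_add, smul_smul]

lemma comp_add (a : Rn n) (hf : HasLap f (a + x) L) : HasLap (fun y => f (a + y)) x L := by
  obtain ⟨d, d2, h1, h2⟩ := hf
  refine ⟨d, d2, fun i => (h1 i).congr (Eventually.of_forall fun s => ?_), h2⟩
  simp [add_assoc]

lemma nonneg_of_min (hf : HasLap f x L) (h : ∀ᶠ y in 𝓝 x, f x ≤ f y) : 0 ≤ L := by
  obtain ⟨d, d2, h1, h2⟩ := hf
  rw [← h2]
  refine Finset.sum_nonneg fun i _ => ((h1 i).of_min ?_).2
  simpa using (tendsto_add_smul x _).eventually h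

lemma of_contDiffAt (hf : ContDiffAt ℝ 2 f x) : HasLap f x (laplacianR f x) := by
  refine ⟨fun i => fderiv ℝ f x (EuclideanSpace.single i 1), _, fun i => ?_, rfl⟩
  set v : Rn n := EuclideanSpace.single i 1
  have hline : ∀ s : ℝ, HasDerivAt (fun s : ℝ => x + s • v) v s := fun s => by
    simpa using ((hasDerivAt_id s).smul_const v).const_add x
  have hdiff : ∀ᶠ y in 𝓝 x, DifferentiableAt ℝ f y := by
    have := hf.eventually (by simp)
    filter_upwards [this] with y hy using hy.differentiableAt (by simp)
  refine ⟨fun s => fderiv ℝ f (x + s • v) v, ?_, by simp [v], ?_⟩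
  · filter_upwards [(tendsto_add_smul x v).eventually hdiff] with s hs
    exact hs.hasFDerivAt.comp_hasDerivAt s (hline s)
  · have hd : DifferentiableAt ℝ (fderiv ℝ f) x :=
      (hf.fderiv_right (m := 1) (by norm_num)).differentiableAt (by simp)
    have h1 : HasDerivAt (fun s : ℝ => fderiv ℝ f (x + s • v)) (fderiv ℝ (fderiv ℝ f) x v) 0 :=
      HasFDerivAt.comp_hasDerivAt_of_eq (f := fun s : ℝ => x + s • v) (0 : ℝ)
        hd.hasFDerivAt (hline 0) (by simp)
    have h2 : HasDerivAt (fun s : ℝ => fderiv ℝ f (x + s • v) v)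
        (fderiv ℝ (fderiv ℝ f) x v v) 0 := by
      simpa using h1.clm_apply (hasDerivAt_const (0 : ℝ) v)
    simpa [iteratedFDeriv_two_apply, v] using h2

/-- The Laplacian of a radial function. -/
lemma radial (x : Rn n) {G G' : ℝ → ℝ} {G'' : ℝ}
    (h1 : ∀ᶠ y in 𝓝 (‖x‖ ^ 2), HasDerivAt G (G' y) y) (h2 : HasDerivAt G' G'' (‖x‖ ^ 2)) :
    HasLap (fun y => G (‖y‖ ^ 2)) x (4 * ‖x‖ ^ 2 * G'' + 2 * n * G' (‖x‖ ^ 2)) := by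
  have hq : ∀ i, HasD2 (fun s : ℝ => ‖x + s • EuclideanSpace.single i (1 : ℝ)‖ ^ 2)
      (2 * x i) 2 := by
    intro i
    refine ⟨fun s => 2 * x i + 2 * s, Eventually.of_forall fun s => ?_, by simp, ?_⟩
    · have h : (fun s : ℝ => ‖x + s • EuclideanSpace.single i (1 : ℝ)‖ ^ 2) =
          fun s => ‖x‖ ^ 2 + 2 * x i * s + s ^ 2 := by
        ext s
        rw [norm_add_sq_real]
        simp [inner_smul_right, norm_smul, EuclideanSpace.inner_single_right]
        ring
      rw [h]
      exact (((hasDerivAt_const s (‖x‖ ^ 2)).add ((hasDerivAt_id s).const_mul (2 * x i))).add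
        (hasDerivAt_pow 2 s)).congr_deriv (by simp)
    · simpa using ((hasDerivAt_id (0 : ℝ)).const_mul 2).const_add (2 * x i)
  refine ⟨_, _, fun i => (hq i).comp (G := G) (G' := G') (G'' := G'')
    (by simpa using h1) (by simpa using h2), ?_⟩
  have hx : ‖x‖ ^ 2 = ∑ i, x i ^ 2 := by
    rw [EuclideanSpace.norm_eq, Real.sq_sqrt (Finset.sum_nonneg fun i _ => sq_nonneg _)]
    simp
  rw [Finset.sum_add_distrib]
  simp only [zero_smul, add_zero, Finset.sum_const, Finset.card_univ, Fintype.card_fin, mul_pow]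
  rw [← Finset.mul_sum, ← Finset.mul_sum, ← hx]
  simp
  ring

lemma norm_sq (x : Rn n) : HasLap (fun y => ‖y‖ ^ 2) x (2 * n) := by
  simpa using radial x (G := fun y => y) (G' := fun _ => 1) (G'' := 0)
    (Eventually.of_forall fun y => hasDerivAt_id y) (hasDerivAt_const _ _)

lemma inv_norm_pow {N : ℕ} {x : Rn (N + 2)} (hx : x ≠ 0) :
    HasLap (fun y => (‖y‖ ^ N)⁻¹) x 0 := by
  have hpos : 0 < ‖x‖ ^ 2 := by positivity
  set p : ℝ := -(N : ℝ) / 2 with hp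
  have key : ∀ (q y : ℝ), 0 < y → HasDerivAt (fun y : ℝ => y ^ q) (q * y ^ (q - 1)) y :=
    fun q y hy => Real.hasDerivAt_rpow_const (Or.inl hy.ne')
  have := radial (n := N + 2) x (G := fun y => y ^ p) (G' := fun y => p * y ^ (p - 1))
    (G'' := p * ((p - 1) * (‖x‖ ^ 2) ^ (p - 1 - 1)))
    ((isOpen_Ioi.eventually_mem hpos).mono fun y hy => key p y hy)
    ((key (p - 1) _ hpos).const_mul p)
  have hz : 4 * ‖x‖ ^ 2 * (p * ((p - 1) * (‖x‖ ^ 2) ^ (p - 1 - 1))) +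
      2 * ((N + 2 : ℕ) : ℝ) * (p * (‖x‖ ^ 2) ^ (p - 1)) = 0 := by
    have : (‖x‖ ^ 2) ^ (p - 1) = ‖x‖ ^ 2 * (‖x‖ ^ 2) ^ (p - 1 - 1) := by
      rw [Real.rpow_sub_one hpos.ne' (p - 1)]
      field_simp
    rw [this, hp]
    push_cast
    ring
  rw [hz] at this
  refine this.congr (Eventually.of_forall fun y => ?_)
  simp only []
  rw [← Real.rpow_natCast ‖y‖ 2, ← Real.rpow_mul (norm_nonneg y), hp, ← Real.rpow_natCast ‖y‖ N,
    ← Real.rpow_neg (norm_nonneg y)]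
  congr 1
  push_cast
  ring

end HasLap
/-- Local form of the comparison principle for `(s A ^ (-β) + t B ^ (-β)) ^ (-1/β)`: its
supremal convolution cannot touch a multiple of a strictly superharmonic function from below. -/
lemma laplacian_nonneg_of_touching {n : ℕ} {A B W : Rn n → ℝ} {ξ₀ ξ₁ : Rn n} {s t Q L : ℝ}
    {β : ℕ} (hβ : 1 ≤ β) (hs : 0 < s) (ht : 0 < t) (hQ : 0 < Q)
    (hA : HasLap A ξ₀ 0) (hB : HasLap B ξ₁ 0) (hW : HasLap W (s • ξ₀ + t • ξ₁) L)
    (hA0 : 0 < A ξ₀) (hB0 : 0 < B ξ₁) (hW0 : 0 < W (s • ξ₀ + t • ξ₁))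
    (heq : (W (s • ξ₀ + t • ξ₁) ^ β)⁻¹ = Q * (s * (A ξ₀ ^ β)⁻¹ + t * (B ξ₁ ^ β)⁻¹))
    (hmin : ∀ᶠ p in 𝓝 (ξ₀, ξ₁), (W (s • p.1 + t • p.2) ^ β)⁻¹ ≤
      Q * (s * (A p.1 ^ β)⁻¹ + t * (B p.2 ^ β)⁻¹)) :
    0 ≤ L := by
  obtain ⟨dA, dA2, hA1, hA2⟩ := hA
  obtain ⟨dB, dB2, hB1, hB2⟩ := hB
  obtain ⟨dW, dW2, hW1, hW2⟩ := hW
  set a := A ξ₀ with ha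
  set b := B ξ₁ with hb
  set η := s • ξ₀ + t • ξ₁ with hη
  set w := W η with hw
  have hβ' : (0 : ℝ) < β := by exact_mod_cast hβ
  set α₀ : ℝ := Q * w ^ β / a ^ β with hα₀
  set α₁ : ℝ := Q * w ^ β / b ^ β with hα₁
  have hα : s * α₀ + t * α₁ = 1 := by
    have h1 : s * α₀ + t * α₁ = w ^ β * (Q * (s * (a ^ β)⁻¹ + t * (b ^ β)⁻¹)) := by
      rw [hα₀, hα₁]; field_simp
    rw [h1, ← heq]
    field_simp
  -- the touching inequality along a line with velocity `(c₀ e i, c₁ e i)`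
  have line : ∀ i (c₀ c₁ c : ℝ), s * c₀ + t * c₁ = c →
      HasD2 (fun r => Q * (s * (A (ξ₀ + (c₀ * r) • EuclideanSpace.single i (1 : ℝ)) ^ β)⁻¹ +
          t * (B (ξ₁ + (c₁ * r) • EuclideanSpace.single i (1 : ℝ)) ^ β)⁻¹) +
          -1 * (W (η + (c * r) • EuclideanSpace.single i (1 : ℝ)) ^ β)⁻¹)
        (Q * (s * (-(β : ℝ) * (c₀ * dA i) / a ^ (β + 1)) +
          t * (-(β : ℝ) * (c₁ * dB i) / b ^ (β + 1))) +
          -1 * (-(β : ℝ) * (c * dW i) / w ^ (β + 1)))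
        (Q * (s * (β * (β + 1) * (c₀ * dA i) ^ 2 / a ^ (β + 2)
              - β * (c₀ ^ 2 * dA2 i) / a ^ (β + 1)) +
          t * (β * (β + 1) * (c₁ * dB i) ^ 2 / b ^ (β + 2)
              - β * (c₁ ^ 2 * dB2 i) / b ^ (β + 1))) +
          -1 * (β * (β + 1) * (c * dW i) ^ 2 / w ^ (β + 2)
              - β * (c ^ 2 * dW2 i) / w ^ (β + 1))) ∧
      ∀ᶠ r : ℝ in 𝓝 0, Q * (s * (A (ξ₀ + (c₀ * (0 : ℝ)) • EuclideanSpace.single i (1 : ℝ)) ^ β)⁻¹ +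
          t * (B (ξ₁ + (c₁ * (0 : ℝ)) • EuclideanSpace.single i (1 : ℝ)) ^ β)⁻¹) +
          -1 * (W (η + (c * (0 : ℝ)) • EuclideanSpace.single i (1 : ℝ)) ^ β)⁻¹ ≤
        Q * (s * (A (ξ₀ + (c₀ * r) • EuclideanSpace.single i (1 : ℝ)) ^ β)⁻¹ +
          t * (B (ξ₁ + (c₁ * r) • EuclideanSpace.single i (1 : ℝ)) ^ β)⁻¹) +
          -1 * (W (η + (c * r) • EuclideanSpace.single i (1 : ℝ)) ^ β)⁻¹ := by
    intro i c₀ c₁ c hc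
    set e : Rn n := EuclideanSpace.single i (1 : ℝ) with he
    refine ⟨?_, ?_⟩
    · have h1 := ((hA1 i).comp_mul c₀).inv_pow (by simpa using hA0.ne') β
      have h2 := ((hB1 i).comp_mul c₁).inv_pow (by simpa using hB0.ne') β
      have h3 := ((hW1 i).comp_mul c).inv_pow (by simpa using hW0.ne') β
      simp only [mul_zero, zero_smul, add_zero, ← ha, ← hb, ← hw] at h1 h2 h3
      exact (((h1.const_mul s).add (h2.const_mul t)).const_mul Q).add (h3.const_mul (-1))
    · have hten : Tendsto (fun r : ℝ => (ξ₀ + (c₀ * r) • e, ξ₁ + (c₁ * r) • e)) (𝓝 0)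
          (𝓝 (ξ₀, ξ₁)) := by
        have : ContinuousAt (fun r : ℝ => (ξ₀ + (c₀ * r) • e, ξ₁ + (c₁ * r) • e)) 0 := by fun_prop
        simpa [ContinuousAt] using this
      filter_upwards [hten.eventually hmin] with r hr
      have h1 : s • (ξ₀ + (c₀ * r) • e) + t • (ξ₁ + (c₁ * r) • e) = η + (c * r) • e := by
        rw [hη, ← hc]; module
      simp only [h1] at hr
      simp only [mul_zero, zero_smul, add_zero]
      rw [← ha, ← hb, ← hw, heq]
      linarith
  have first₀ : ∀ i, dA i = dW i * a ^ (β + 1) / (Q * w ^ (β + 1)) := by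
    intro i
    obtain ⟨h1, h2⟩ := line i 1 0 s (by ring)
    have := (h1.of_min h2).1
    simp only [one_mul, zero_mul, mul_zero, zero_div, add_zero] at this
    have h3 : (β * s) * (Q * dA i / a ^ (β + 1) - dW i / w ^ (β + 1)) = 0 := by
      linear_combination -this
    have h4 := sub_eq_zero.1 ((mul_eq_zero.1 h3).resolve_left (by positivity))
    rw [div_eq_div_iff (by positivity) (by positivity)] at h4
    rw [eq_div_iff (by positivity)]
    linear_combination h4
  have first₁ : ∀ i, dB i = dW i * b ^ (β + 1) / (Q * w ^ (β + 1)) := by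
    intro i
    obtain ⟨h1, h2⟩ := line i 0 1 t (by ring)
    have := (h1.of_min h2).1
    simp only [one_mul, zero_mul, mul_zero, zero_div, zero_add] at this
    have h3 : (β * t) * (Q * dB i / b ^ (β + 1) - dW i / w ^ (β + 1)) = 0 := by
      linear_combination -this
    have h4 := sub_eq_zero.1 ((mul_eq_zero.1 h3).resolve_left (by positivity))
    rw [div_eq_div_iff (by positivity) (by positivity)] at h4
    rw [eq_div_iff (by positivity)]
    linear_combination h4
  have second : ∀ i, Q * s * α₀ ^ 2 / a ^ (β + 1) * dA2 i + Q * t * α₁ ^ 2 / b ^ (β + 1) * dB2 i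
      ≤ 1 / w ^ (β + 1) * dW2 i := by
    intro i
    obtain ⟨h1, h2⟩ := line i α₀ α₁ 1 hα
    have h3 := (h1.of_min h2).2
    have e0 : (α₀ * dA i) ^ 2 / a ^ (β + 2) = dW i ^ 2 / w ^ 2 * (a ^ β)⁻¹ := by
      rw [first₀ i, hα₀]; field_simp; ring
    have e1 : (α₁ * dB i) ^ 2 / b ^ (β + 2) = dW i ^ 2 / w ^ 2 * (b ^ β)⁻¹ := by
      rw [first₁ i, hα₁]; field_simp; ring
    have e2 : (1 * dW i) ^ 2 / w ^ (β + 2) = dW i ^ 2 / w ^ 2 * (w ^ β)⁻¹ := by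
      field_simp
      ring
    rw [heq] at e2
    have h4 : (β : ℝ) * (Q * s * α₀ ^ 2 / a ^ (β + 1) * dA2 i
        + Q * t * α₁ ^ 2 / b ^ (β + 1) * dB2 i) ≤ β * (1 / w ^ (β + 1) * dW2 i) := by
      simp only [mul_div_assoc] at h3 e0 e1 e2 ⊢
      rw [e0, e1, e2] at h3
      ring_nf at h3 ⊢
      linarith
    exact le_of_mul_le_mul_left h4 hβ'
  have hsum := Finset.sum_le_sum fun i (_ : i ∈ Finset.univ) => second i
  rw [Finset.sum_add_distrib, ← Finset.mul_sum, ← Finset.mul_sum, ← Finset.mul_sum, hA2, hB2,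
    hW2] at hsum
  have : 0 ≤ 1 / w ^ (β + 1) * L := by simpa using hsum
  exact nonneg_of_mul_nonneg_right this (by positivity)

/-- The minimum principle for superharmonic functions. -/
lemma nonneg_of_superharmonic {n : ℕ} (hn : 0 < n) {U : Set (Rn n)} {h : Rn n → ℝ} (hU : IsOpen U)
    (hb : Bornology.IsBounded U) (hc : ContinuousOn h U)
    (hlap : ∀ x ∈ U, ∃ L ≤ 0, HasLap h x L)
    (hbdry : ∀ ε > 0, ∃ K ⊆ U, IsCompact K ∧ ∀ x ∈ U, x ∉ K → -ε ≤ h x) :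
    ∀ x ∈ U, 0 ≤ h x := by
  intro x hx
  by_contra! hneg
  obtain ⟨R, hR⟩ := hb.exists_norm_le
  have hR0 : 0 ≤ R := (norm_nonneg x).trans (hR x hx)
  set m := -h x with hm
  have hm0 : 0 < m := by linarith
  obtain ⟨K, hKU, hK, hKh⟩ := hbdry (m / 4) (by positivity)
  set δ := m / (4 * (R ^ 2 + 1)) with hδ
  have hδ0 : 0 < δ := by positivity
  have hδR : δ * R ^ 2 ≤ m / 4 := by
    have : δ * (R ^ 2 + 1) = m / 4 := by rw [hδ]; field_simp
    nlinarith
  have hcont : ContinuousOn (fun y => h y + -δ * ‖y‖ ^ 2) (insert x K) :=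
    (hc.add (by fun_prop)).mono (insert_subset hx hKU)
  obtain ⟨y, hy, hymin⟩ := (hK.insert x).exists_isMinOn ⟨x, mem_insert _ _⟩ hcont
  have hyU : y ∈ U := insert_subset hx hKU hy
  have hyx : h y + -δ * ‖y‖ ^ 2 ≤ -m := by
    have : h y + -δ * ‖y‖ ^ 2 ≤ h x + -δ * ‖x‖ ^ 2 := hymin (mem_insert _ _)
    nlinarith [mul_nonneg hδ0.le (sq_nonneg ‖x‖)]
  have hglob : ∀ z ∈ U, h y + -δ * ‖y‖ ^ 2 ≤ h z + -δ * ‖z‖ ^ 2 := by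
    intro z hz
    by_cases hzK : z ∈ insert x K
    · exact hymin hzK
    · have h1 := hKh z hz fun h' => hzK (mem_insert_of_mem _ h')
      have h2 : ‖z‖ ^ 2 ≤ R ^ 2 := pow_le_pow_left₀ (norm_nonneg _) (hR z hz) 2
      nlinarith [mul_le_mul_of_nonneg_left h2 hδ0.le]
  obtain ⟨L, hL, hLy⟩ := hlap y hyU
  have := (hLy.add ((HasLap.norm_sq y).const_mul (-δ))).nonneg_of_min
    ((hU.eventually_mem hyU).mono hglob)
  have hn' : (0 : ℝ) < n := by exact_mod_cast hn
  nlinarith [mul_pos hδ0 hn']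

/-- A set that spreads from points to concentric balls fills up the connected set `U`. -/
lemma subset_of_ball_spreading {n : ℕ} {U S : Set (Rn n)} (hU : IsOpen U) (hUc : IsPreconnected U)
    (hS : IsOpen S) (hne : (U ∩ S).Nonempty)
    (hspread : ∀ y ∈ S, ∀ R, Metric.closedBall y R ⊆ U → Metric.ball y R ⊆ S) : U ⊆ S := by
  refine hUc.subset_of_closure_inter_subset hS hne ?_
  rintro x ⟨hxS, hxU⟩
  obtain ⟨ρ, hρ, hball⟩ := Metric.isOpen_iff.1 hU x hxU
  obtain ⟨y, hyS, hxy⟩ := Metric.mem_closure_iff.1 hxS (ρ / 2) (by positivity)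
  refine hspread y hyS (ρ / 2) (fun z hz => hball ?_) (Metric.mem_ball.2 hxy)
  rw [Metric.mem_closedBall] at hz
  rw [Metric.mem_ball]
  have := dist_triangle z y x
  rw [dist_comm y x] at this
  linarith

/-- A Hopf barrier: it is strictly subharmonic away from `y`. -/
lemma exists_barrier {n : ℕ} (y : Rn n) {r R : ℝ} (hr : 0 < r) :
    ∃ κ : Rn n → ℝ, Continuous κ ∧ (∀ x, κ x ≤ 1) ∧ (∀ x, dist x y ≤ R → 0 ≤ κ x) ∧
      (∀ x, dist x y = R → κ x = 0) ∧ (∀ x, dist x y < R → 0 < κ x) ∧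
      ∀ x, r ≤ dist x y → ∃ L > 0, HasLap κ x L := by
  set α : ℝ := (n + 1) / r ^ 2 with hα
  have hα0 : 0 < α := by positivity
  refine ⟨fun x => Real.exp (-α * ‖-y + x‖ ^ 2) + -Real.exp (-α * R ^ 2), by fun_prop, ?_, ?_, ?_,
    ?_, ?_⟩
  · intro x
    have h1 : Real.exp (-α * ‖-y + x‖ ^ 2) ≤ 1 := by
      rw [Real.exp_le_one_iff]
      nlinarith [mul_nonneg hα0.le (sq_nonneg ‖-y + x‖)]
    have := Real.exp_pos (-α * R ^ 2)
    linarith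
  · intro x hx
    rw [dist_eq_norm, sub_eq_neg_add] at hx
    have h2 := pow_le_pow_left₀ (norm_nonneg _) hx 2
    have : Real.exp (-α * R ^ 2) ≤ Real.exp (-α * ‖-y + x‖ ^ 2) := by
      apply Real.exp_le_exp.2
      nlinarith
    linarith
  · intro x hx
    rw [dist_eq_norm, sub_eq_neg_add] at hx
    simp [hx]
  · intro x hx
    rw [dist_eq_norm, sub_eq_neg_add] at hx
    have h2 := pow_lt_pow_left₀ hx (norm_nonneg _) two_ne_zero
    have : Real.exp (-α * R ^ 2) < Real.exp (-α * ‖-y + x‖ ^ 2) := by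
      apply Real.exp_lt_exp.2
      nlinarith
    linarith
  · intro x hx
    rw [dist_eq_norm, sub_eq_neg_add] at hx
    have key : ∀ z : ℝ, HasDerivAt (fun z : ℝ => Real.exp (-α * z)) (-α * Real.exp (-α * z)) z :=
      fun z => by
        have := ((hasDerivAt_id z).const_mul (-α)).exp
        simpa [mul_comm] using this
    have h1 := (HasLap.radial (-y + x) (Eventually.of_forall key) ((key _).const_mul (-α))).comp_add
    refine ⟨_, ?_, h1.add (HasLap.const _)⟩
    have h2 : r ^ 2 ≤ ‖-y + x‖ ^ 2 := pow_le_pow_left₀ hr.le hx 2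
    have h3 : (n + 1 : ℝ) ≤ α * ‖-y + x‖ ^ 2 := by
      have : α * r ^ 2 = n + 1 := by rw [hα]; field_simp
      nlinarith
    have h4 : 4 * ‖-y + x‖ ^ 2 * (-α * (-α * Real.exp (-α * ‖-y + x‖ ^ 2)))
        + 2 * n * (-α * Real.exp (-α * ‖-y + x‖ ^ 2)) + 0
        = (4 * (α * ‖-y + x‖ ^ 2) - 2 * n) * (α * Real.exp (-α * ‖-y + x‖ ^ 2)) := by ring
    rw [h4]
    have := Real.exp_pos (-α * ‖-y + x‖ ^ 2)
    have hn0 : (0 : ℝ) ≤ n := Nat.cast_nonneg n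
    exact mul_pos (by linarith) (by positivity)

/-- The properties of the reciprocal `k` of a Green function with pole `0`, normalised so that
`k ξ ∼ ‖ξ‖ ^ N` at the pole, that enter the comparison arguments. -/
structure IsGauge (N : ℕ) (U : Set (Rn (N + 2))) (k : Rn (N + 2) → ℝ) : Prop where
  isOpen : IsOpen U
  isBounded : Bornology.IsBounded U
  zero_mem : 0 ∈ U
  continuousOn : ContinuousOn k U
  map_zero : k 0 = 0
  pos : ∀ ξ ∈ U, ξ ≠ 0 → 0 < k ξ
  isCompact : ∀ C, IsCompact {ξ ∈ U | k ξ ≤ C}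
  norm_le : ∀ ξ ∈ U, ‖ξ‖ ^ N ≤ k ξ
  pole : ∀ l > 1, ∀ᶠ ξ in 𝓝 0, k ξ ≤ l * ‖ξ‖ ^ N
  harmonic : ∀ ξ ∈ U, ξ ≠ 0 → HasLap (fun y => (k y)⁻¹) ξ 0

namespace IsGauge

variable {N : ℕ} {U U₀ U₁ K : Set (Rn (N + 2))} {k k₀ k₁ V : Rn (N + 2) → ℝ} {s t : ℝ}

lemma nonneg (h : IsGauge N U k) {ξ : Rn (N + 2)} (hξ : ξ ∈ U) : 0 ≤ k ξ :=
  (by positivity : (0 : ℝ) ≤ ‖ξ‖ ^ N).trans (h.norm_le ξ hξ)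

lemma norm_pow_le (h₀ : IsGauge N U₀ k₀) (h₁ : IsGauge N U₁ k₁) (hs : 0 < s) (ht : 0 < t)
    (hst : s + t = 1) (β : ℕ) {ξ₀ ξ₁ : Rn (N + 2)} (hξ₀ : ξ₀ ∈ U₀) (hξ₁ : ξ₁ ∈ U₁) :
    (‖s • ξ₀ + t • ξ₁‖ ^ N) ^ β ≤ s * k₀ ξ₀ ^ β + t * k₁ ξ₁ ^ β := by
  have h1 : ‖s • ξ₀ + t • ξ₁‖ ≤ s * ‖ξ₀‖ + t * ‖ξ₁‖ := by
    refine (norm_add_le _ _).trans_eq ?_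
    rw [norm_smul, norm_smul, Real.norm_of_nonneg hs.le, Real.norm_of_nonneg ht.le]
  have h2 : (s * ‖ξ₀‖ + t * ‖ξ₁‖) ^ (N * β) ≤ s * ‖ξ₀‖ ^ (N * β) + t * ‖ξ₁‖ ^ (N * β) := by
    simpa using (convexOn_pow (N * β)).2 (norm_nonneg ξ₀) (norm_nonneg ξ₁) hs.le ht.le hst
  have h3 := pow_le_pow_left₀ (by positivity) (h₀.norm_le ξ₀ hξ₀) β
  have h4 := pow_le_pow_left₀ (by positivity) (h₁.norm_le ξ₁ hξ₁) β
  rw [← pow_mul] at h3 h4 ⊢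
  calc ‖s • ξ₀ + t • ξ₁‖ ^ (N * β) ≤ _ := pow_le_pow_left₀ (norm_nonneg _) h1 _
    _ ≤ _ := h2
    _ ≤ _ := by gcongr

/-- Comparison of `V ^ β` with `s k₀ ^ β + t k₁ ^ β`. -/
lemma comparison (hN : 1 ≤ N) (h₀ : IsGauge N U₀ k₀) (h₁ : IsGauge N U₁ k₁) (hs : 0 < s)
    (ht : 0 < t) (hst : s + t = 1) {β : ℕ} (hβ : 1 ≤ β) (hK : IsCompact K) (hV : ContinuousOn V K)
    (hVpos : ∀ η ∈ K, η ≠ 0 → 0 < V η)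
    (hpole : ∀ l > 1, ∀ᶠ η in 𝓝 0, η ∈ K → V η ^ β ≤ l * (‖η‖ ^ N) ^ β)
    (hray₀ : ∀ ξ ∈ U₀, s • ξ ∈ K → V (s • ξ) ^ β ≤ s * k₀ ξ ^ β)
    (hray₁ : ∀ ξ ∈ U₁, t • ξ ∈ K → V (t • ξ) ^ β ≤ t * k₁ ξ ^ β)
    (hK' : ∀ η ∈ K, η ≠ 0 →
      (∀ ξ₀ ∈ U₀, ∀ ξ₁ ∈ U₁, s • ξ₀ + t • ξ₁ = η → V η ^ β ≤ s * k₀ ξ₀ ^ β + t * k₁ ξ₁ ^ β) ∨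
        (K ∈ 𝓝 η ∧ ∃ L < 0, HasLap (fun y => (V y)⁻¹) η L)) :
    ∀ ξ₀ ∈ U₀, ∀ ξ₁ ∈ U₁, s • ξ₀ + t • ξ₁ ∈ K →
      V (s • ξ₀ + t • ξ₁) ^ β ≤ s * k₀ ξ₀ ^ β + t * k₁ ξ₁ ^ β := by
  intro a ha b hb hab
  by_contra! hlt
  set M : Rn (N + 2) × Rn (N + 2) → ℝ := fun p => s * k₀ p.1 ^ β + t * k₁ p.2 ^ β with hM
  set σ : Rn (N + 2) × Rn (N + 2) → Rn (N + 2) := fun p => s • p.1 + t • p.2 with hσ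
  have hσc : Continuous σ := by fun_prop
  have hnorm : ∀ p : Rn (N + 2) × Rn (N + 2), p.1 ∈ U₀ → p.2 ∈ U₁ → (‖σ p‖ ^ N) ^ β ≤ M p :=
    fun p h1 h2 => norm_pow_le h₀ h₁ hs ht hst β h1 h2
  have hMpos : ∀ p : Rn (N + 2) × Rn (N + 2), p.1 ∈ U₀ → p.2 ∈ U₁ → σ p ≠ 0 → 0 < M p :=
    fun p h1 h2 h3 => lt_of_lt_of_le (by positivity) (hnorm p h1 h2)
  have hM0 : ∀ p : Rn (N + 2) × Rn (N + 2), p.1 ∈ U₀ → p.2 ∈ U₁ → 0 ≤ M p :=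
    fun p h1 h2 => le_trans (by positivity) (hnorm p h1 h2)
  change M (a, b) < V (σ (a, b)) ^ β at hlt
  change σ (a, b) ∈ K at hab
  have hη0 : σ (a, b) ≠ 0 := by
    intro h0
    have h1 := (hpole 2 one_lt_two).self_of_nhds (h0 ▸ hab)
    rw [norm_zero, zero_pow (by omega), zero_pow (by omega), mul_zero] at h1
    rw [h0] at hlt
    linarith [hM0 (a, b) ha hb]
  have hMab := hMpos (a, b) ha hb hη0
  set l₀ := V (σ (a, b)) ^ β / M (a, b) with hl₀
  have hl₀1 : 1 < l₀ := (one_lt_div hMab).2 hlt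
  obtain ⟨l, hl1, hll₀⟩ := exists_between hl₀1
  obtain ⟨ρ, hρ, hball⟩ := Metric.eventually_nhds_iff.1 (hpole l hl1)
  have hnear : ∀ p : Rn (N + 2) × Rn (N + 2), p.1 ∈ U₀ → p.2 ∈ U₁ → σ p ∈ K → ‖σ p‖ < ρ →
      V (σ p) ^ β ≤ l * M p := fun p h1 h2 h3 h4 =>
    (hball (by simpa using h4) h3).trans (mul_le_mul_of_nonneg_left (hnorm p h1 h2) (by linarith))
  obtain ⟨B, hB⟩ := (hK.image_of_continuousOn (hV.pow β)).bddAbove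
  have hB' : ∀ η ∈ K, V η ^ β ≤ B := fun η hη => hB (mem_image_of_mem _ hη)
  obtain ⟨C, hC⟩ : ∃ C : ℝ, 1 ≤ C ∧ B / s ≤ C ∧ B / t ≤ C ∧ k₀ a ≤ C ∧ k₁ b ≤ C :=
    ⟨max 1 (max (B / s) (max (B / t) (max (k₀ a) (k₁ b)))), by simp⟩
  obtain ⟨hC1, hCs, hCt, hCa, hCb⟩ := hC
  rw [div_le_iff₀ hs] at hCs
  rw [div_le_iff₀ ht] at hCt
  set P : Set (Rn (N + 2) × Rn (N + 2)) :=
    ({ξ ∈ U₀ | k₀ ξ ≤ C} ×ˢ {ξ ∈ U₁ | k₁ ξ ≤ C}) ∩ σ ⁻¹' (K ∩ {η | ρ ≤ ‖η‖}) with hP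
  have hPc : IsCompact P := ((h₀.isCompact C).prod (h₁.isCompact C)).inter_right
    ((hK.isClosed.inter (isClosed_le continuous_const continuous_norm)).preimage hσc)
  have hne : ∀ p ∈ P, σ p ≠ 0 := fun p hp h => by
    have : ρ ≤ ‖σ p‖ := hp.2.2
    rw [h, norm_zero] at this
    linarith
  have hMc : ContinuousOn M P := by
    have h1 : ContinuousOn (fun p : Rn (N + 2) × Rn (N + 2) => k₀ p.1) P :=
      h₀.continuousOn.comp continuousOn_fst fun p hp => hp.1.1.1
    have h2 : ContinuousOn (fun p : Rn (N + 2) × Rn (N + 2) => k₁ p.2) P :=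
      h₁.continuousOn.comp continuousOn_snd fun p hp => hp.1.2.1
    exact (continuousOn_const.mul (h1.pow β)).add (continuousOn_const.mul (h2.pow β))
  have hf : ContinuousOn (fun p => V (σ p) ^ β / M p) P :=
    ((hV.comp hσc.continuousOn fun p hp => hp.2.1).pow β).div hMc
      fun p hp => (hMpos p hp.1.1.1 hp.1.2.1 (hne p hp)).ne'
  have habP : (a, b) ∈ P := by
    refine ⟨⟨⟨ha, hCa⟩, hb, hCb⟩, hab, ?_⟩
    by_contra! hlt'
    have h1 := hnear (a, b) ha hb hab (not_le.1 hlt')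
    rw [← div_le_iff₀ hMab] at h1
    linarith
  obtain ⟨p, hp, hmax⟩ := hPc.exists_isMaxOn ⟨_, habP⟩ hf
  set Q := V (σ p) ^ β / M p with hQ
  have hQl : l₀ ≤ Q := hmax habP
  have hp0 := hp.1.1.1
  have hp1 := hp.1.2.1
  have hMp := hMpos p hp0 hp1 (hne p hp)
  have hVp : V (σ p) ^ β = Q * M p := by rw [hQ]; field_simp
  have hMQ : M p < Q * M p := by nlinarith
  have hglob : ∀ q : Rn (N + 2) × Rn (N + 2), q.1 ∈ U₀ → q.2 ∈ U₁ → σ q ∈ K →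
      V (σ q) ^ β ≤ Q * M q := by
    intro q h1 h2 h3
    have hq := hM0 q h1 h2
    have hC' : C ≤ C ^ β := le_self_pow₀ hC1 (by omega)
    rcases lt_or_ge ‖σ q‖ ρ with h4 | h4
    · exact (hnear q h1 h2 h3 h4).trans (mul_le_mul_of_nonneg_right (by linarith) hq)
    have hx := pow_nonneg (h₀.nonneg h1) β
    have hy := pow_nonneg (h₁.nonneg h2) β
    have hbig : B ≤ M q → V (σ q) ^ β ≤ Q * M q := fun h => by
      nlinarith [hB' _ h3]
    by_cases h5 : k₀ q.1 ≤ C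
    · by_cases h6 : k₁ q.2 ≤ C
      · have hqP : q ∈ P := ⟨⟨⟨h1, h5⟩, h2, h6⟩, h3, h4⟩
        have h7 : V (σ q) ^ β / M q ≤ Q := hmax hqP
        rwa [div_le_iff₀ (hMpos q h1 h2 (hne q hqP))] at h7
      · refine hbig ?_
        have h7 := pow_le_pow_left₀ (by linarith) (not_le.1 h6).le β
        simp only [hM]
        nlinarith
    · refine hbig ?_
      have h7 := pow_le_pow_left₀ (by linarith) (not_le.1 h5).le β
      simp only [hM]
      nlinarith
  rcases hK' (σ p) hp.2.1 (hne p hp) with hgood | ⟨hnhds, L, hL, hlap⟩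
  · have : V (σ p) ^ β ≤ M p := hgood p.1 hp0 p.2 hp1 rfl
    linarith
  by_cases hz0 : p.1 = 0
  · have h1 : σ p = t • p.2 := by simp [hσ, hz0]
    have h2 := hray₁ p.2 hp1 (h1 ▸ hp.2.1)
    rw [← h1] at h2
    have h3 : t * k₁ p.2 ^ β ≤ M p := by
      have := mul_nonneg hs.le (pow_nonneg (h₀.nonneg hp0) β)
      simp only [hM]; linarith
    linarith
  by_cases hz1 : p.2 = 0
  · have h1 : σ p = s • p.1 := by simp [hσ, hz1]
    have h2 := hray₀ p.1 hp0 (h1 ▸ hp.2.1)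
    rw [← h1] at h2
    have h3 : s * k₀ p.1 ^ β ≤ M p := by
      have := mul_nonneg ht.le (pow_nonneg (h₁.nonneg hp1) β)
      simp only [hM]; linarith
    linarith
  refine absurd hL (not_lt.2 (laplacian_nonneg_of_touching (Q := Q) hβ hs ht (by linarith)
    (h₀.harmonic p.1 hp0 hz0) (h₁.harmonic p.2 hp1 hz1) hlap (inv_pos.2 (h₀.pos _ hp0 hz0))
    (inv_pos.2 (h₁.pos _ hp1 hz1)) (inv_pos.2 (hVpos _ hp.2.1 (hne p hp))) ?_ ?_))
  · simpa only [inv_pow, inv_inv] using hVp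
  · have h1 : ∀ᶠ q : Rn (N + 2) × Rn (N + 2) in 𝓝 (p.1, p.2), q.1 ∈ U₀ :=
      continuousAt_fst.eventually (h₀.isOpen.eventually_mem hp0)
    have h2 : ∀ᶠ q : Rn (N + 2) × Rn (N + 2) in 𝓝 (p.1, p.2), q.2 ∈ U₁ :=
      continuousAt_snd.eventually (h₁.isOpen.eventually_mem hp1)
    have h3 : ∀ᶠ q in 𝓝 (p.1, p.2), σ q ∈ K := hσc.continuousAt.eventually hnhds
    filter_upwards [h1, h2, h3] with q h4 h5 h6
    simpa only [inv_pow, inv_inv] using hglob q h4 h5 h6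

end IsGauge

namespace IsGauge

variable {N : ℕ} {U U₀ U₁ : Set (Rn (N + 2))} {k k₀ k₁ : Rn (N + 2) → ℝ} {s t : ℝ}

/-- Gauges inherit the convexity of the Minkowski combination of their domains. -/
lemma le_add (hN : 1 ≤ N) (h : IsGauge N U k) (h₀ : IsGauge N U₀ k₀) (h₁ : IsGauge N U₁ k₁)
    (hs : 0 < s) (ht : 0 < t) (hst : s + t = 1)
    (hU : ∀ ξ₀ ∈ U₀, ∀ ξ₁ ∈ U₁, s • ξ₀ + t • ξ₁ ∈ U)
    (hray₀ : ∀ ξ ∈ U₀, k (s • ξ) ≤ s * k₀ ξ) (hray₁ : ∀ ξ ∈ U₁, k (t • ξ) ≤ t * k₁ ξ) :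
    ∀ ξ₀ ∈ U₀, ∀ ξ₁ ∈ U₁, k (s • ξ₀ + t • ξ₁) ≤ s * k₀ ξ₀ + t * k₁ ξ₁ := by
  intro a ha b hb
  obtain ⟨R, hR⟩ := h.isBounded.exists_norm_le
  set A := R ^ 2 + 1 with hA
  have hA1 : ∀ η ∈ U, 1 ≤ A - ‖η‖ ^ 2 := fun η hη => by
    have := pow_le_pow_left₀ (norm_nonneg _) (hR η hη) 2
    linarith
  have key : ∀ δ > 0, k (s • a + t • b) / (1 + k (s • a + t • b) * (δ * (A - ‖s • a + t • b‖ ^ 2)))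
      ≤ s * k₀ a + t * k₁ b := by
    intro δ hδ
    obtain ⟨C, hCa, hCb, hCs, hCt⟩ : ∃ C : ℝ, k₀ a ≤ C ∧ k₁ b ≤ C ∧ 1 / δ / s ≤ C ∧ 1 / δ / t ≤ C :=
      ⟨max (k₀ a) (max (k₁ b) (max (1 / δ / s) (1 / δ / t))), by simp⟩
    rw [div_le_iff₀ hs] at hCs
    rw [div_le_iff₀ ht] at hCt
    have hcomp := ((h₀.isCompact C).prod (h₁.isCompact C)).image_of_continuousOn
      (f := fun p => k (s • p.1 + t • p.2))
      (h.continuousOn.comp (by fun_prop) fun p hp => hU _ hp.1.1 _ hp.2.1)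
    obtain ⟨C₀, hC₀⟩ := hcomp.bddAbove
    have hC₀' : ∀ ξ₀ ∈ U₀, ∀ ξ₁ ∈ U₁, k₀ ξ₀ ≤ C → k₁ ξ₁ ≤ C → k (s • ξ₀ + t • ξ₁) ≤ C₀ :=
      fun ξ₀ h1 ξ₁ h2 h3 h4 => hC₀ ⟨(ξ₀, ξ₁), ⟨⟨h1, h3⟩, h2, h4⟩, rfl⟩
    set K := {η ∈ U | k η ≤ C₀ + 1} with hK
    set V : Rn (N + 2) → ℝ := fun η => k η / (1 + k η * (δ * (A - ‖η‖ ^ 2))) with hV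
    have hden : ∀ η ∈ U, 0 ≤ k η * (δ * (A - ‖η‖ ^ 2)) := fun η hη =>
      mul_nonneg (h.nonneg hη) (mul_nonneg hδ.le (by linarith [hA1 η hη]))
    have hVk : ∀ η ∈ U, V η ≤ k η := fun η hη =>
      div_le_self (h.nonneg hη) (by linarith [hden η hη])
    have hVδ : ∀ η ∈ U, V η ≤ 1 / δ := fun η hη => by
      rw [hV, div_le_div_iff₀ (by linarith [hden η hη]) hδ]
      nlinarith [mul_nonneg (mul_nonneg (h.nonneg hη) hδ.le) (sub_nonneg.2 (hA1 η hη))]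
    have hVpos : ∀ η ∈ U, η ≠ 0 → 0 < V η := fun η hη h0 =>
      div_pos (h.pos η hη h0) (by linarith [hden η hη])
    have hVc : ContinuousOn V U := by
      refine h.continuousOn.div ?_ fun η hη => by linarith [hden η hη]
      exact continuousOn_const.add (h.continuousOn.mul (by fun_prop))
    have := comparison hN h₀ h₁ hs ht hst le_rfl (h.isCompact (C₀ + 1)) (V := V)
      (hVc.mono fun η hη => hη.1) (fun η hη => hVpos η hη.1) ?_ ?_ ?_ ?_ a ha b hb
      ⟨hU a ha b hb, (hC₀' a ha b hb hCa hCb).trans (by linarith)⟩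
    · simpa using this
    · intro l hl
      filter_upwards [h.pole l hl] with η h1 h2
      simpa using (hVk η h2.1).trans h1
    · intro ξ hξ hξK
      simpa using (hVk _ hξK.1).trans (hray₀ ξ hξ)
    · intro ξ hξ hξK
      simpa using (hVk _ hξK.1).trans (hray₁ ξ hξ)
    · intro η hη hη0
      rcases hη.2.lt_or_eq with hlt | heq
      · right
        have hnear : ∀ᶠ y in 𝓝 η, y ∈ U := h.isOpen.eventually_mem hη.1
        have hlt' : ∀ᶠ y in 𝓝 η, k y < C₀ + 1 :=
          (h.continuousOn.continuousAt hnear).eventually_lt_const hlt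
        refine ⟨?_, -δ * (2 * (N + 2 : ℕ)), ?_, ?_⟩
        · filter_upwards [hnear, hlt'] with y h1 h2 using ⟨h1, h2.le⟩
        · have : (0 : ℝ) < (N + 2 : ℕ) := by positivity
          nlinarith
        · have hl := ((h.harmonic η hη.1 hη0).add ((HasLap.norm_sq η).const_mul (-δ))).add
            (HasLap.const (δ * A))
          rw [zero_add, add_zero] at hl
          refine hl.congr ?_
          filter_upwards [hnear, isOpen_ne.eventually_mem hη0] with y h1 h2
          have := h.pos y h1 h2
          simp only [hV, inv_div]
          field_simp
          ring
      · left
        intro ξ₀ hξ₀ ξ₁ hξ₁ hη'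
        have h1 : V η ≤ 1 / δ := hVδ η hη.1
        have hx := mul_nonneg hs.le (h₀.nonneg hξ₀)
        have hy := mul_nonneg ht.le (h₁.nonneg hξ₁)
        simp only [pow_one]
        by_cases h2 : k₀ ξ₀ ≤ C
        · by_cases h3 : k₁ ξ₁ ≤ C
          · have := hC₀' ξ₀ hξ₀ ξ₁ hξ₁ h2 h3
            rw [hη', heq] at this
            linarith
          · nlinarith
        · nlinarith
  have hten : Tendsto (fun δ : ℝ => k (s • a + t • b) /
      (1 + k (s • a + t • b) * (δ * (A - ‖s • a + t • b‖ ^ 2)))) (𝓝[>] 0)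
      (𝓝 (k (s • a + t • b))) := by
    have : ContinuousAt (fun δ : ℝ => k (s • a + t • b) /
      (1 + k (s • a + t • b) * (δ * (A - ‖s • a + t • b‖ ^ 2)))) 0 :=
      ContinuousAt.div (by fun_prop) (by fun_prop) (by simp)
    have h2 := this.tendsto
    simp only [zero_mul, mul_zero, add_zero, div_one] at h2
    exact h2.mono_left nhdsWithin_le_nhds
  exact le_of_tendsto hten (eventually_mem_nhdsWithin.mono fun δ hδ => key δ hδ)

end IsGauge

/-- The points near which the convexity inequality for the squares of the gauges holds with a
definite gain. -/
def gainSet {N : ℕ} (U U₀ U₁ : Set (Rn (N + 2))) (k k₀ k₁ : Rn (N + 2) → ℝ) (s t : ℝ) :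
    Set (Rn (N + 2)) :=
  {y | ∃ ε > 0, ∀ᶠ η in 𝓝 y, η ∈ U ∧ ε * k η < 1 ∧ ∀ ξ₀ ∈ U₀, ∀ ξ₁ ∈ U₁, s • ξ₀ + t • ξ₁ = η →
    (k η / (1 - ε * k η)) ^ 2 ≤ s * k₀ ξ₀ ^ 2 + t * k₁ ξ₁ ^ 2}

lemma isOpen_gainSet {N : ℕ} (U U₀ U₁ : Set (Rn (N + 2))) (k k₀ k₁ : Rn (N + 2) → ℝ) (s t : ℝ) :
    IsOpen (gainSet U U₀ U₁ k k₀ k₁ s t) := by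
  refine isOpen_iff_mem_nhds.2 fun y ⟨ε, hε, h⟩ => ?_
  filter_upwards [h.eventually_nhds] with z hz using ⟨ε, hε, hz⟩

namespace IsGauge

variable {N : ℕ} {U U₀ U₁ : Set (Rn (N + 2))} {k k₀ k₁ : Rn (N + 2) → ℝ} {s t : ℝ}

lemma ball_subset_gainSet (hN : 1 ≤ N) (h : IsGauge N U k) (h₀ : IsGauge N U₀ k₀)
    (h₁ : IsGauge N U₁ k₁) (hs : 0 < s) (ht : 0 < t) (hst : s + t = 1)
    (hU : ∀ ξ₀ ∈ U₀, ∀ ξ₁ ∈ U₁, s • ξ₀ + t • ξ₁ ∈ U)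
    (hray₀ : ∀ ξ ∈ U₀, k (s • ξ) ≤ s * k₀ ξ) (hray₁ : ∀ ξ ∈ U₁, k (t • ξ) ≤ t * k₁ ξ)
    {y : Rn (N + 2)} (hy : y ∈ gainSet U U₀ U₁ k k₀ k₁ s t) {R : ℝ}
    (hR : Metric.closedBall y R ⊆ U) : Metric.ball y R ⊆ gainSet U U₀ U₁ k k₀ k₁ s t := by
  intro z hz
  obtain ⟨ε₀, hε₀, hev⟩ := hy
  obtain ⟨r, hr, hball⟩ := Metric.eventually_nhds_iff.1 hev
  obtain ⟨κ, hκc, hκ1, hκ0, hκR, hκpos, hκlap⟩ := exists_barrier (R := R) y hr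
  have hKc : IsCompact (Metric.closedBall y R) := isCompact_closedBall y R
  obtain ⟨C, hC⟩ := (hKc.image_of_continuousOn (h.continuousOn.mono hR)).bddAbove
  have hkC : ∀ η ∈ Metric.closedBall y R, k η ≤ C := fun η hη => hC (mem_image_of_mem _ hη)
  have hC0 : 0 ≤ C := (h.nonneg (hR (Metric.ball_subset_closedBall hz))).trans
    (hkC z (Metric.ball_subset_closedBall hz))
  set ε := min ε₀ (s * t / (2 * C + 1)) with hε
  have hε0 : 0 < ε := lt_min hε₀ (by positivity)
  have hεC : 2 * (ε * C) ≤ s * t := by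
    have h1 : ε * (2 * C + 1) ≤ s * t := (le_div_iff₀ (by positivity)).1 (min_le_right _ _)
    nlinarith
  have hst4 : s * t < 1 := by nlinarith
  set V : Rn (N + 2) → ℝ := fun η => k η / (1 - ε * κ η * k η) with hV
  have hk0 : ∀ η ∈ Metric.closedBall y R, 0 ≤ k η := fun η hη => h.nonneg (hR hη)
  have hκk : ∀ η ∈ Metric.closedBall y R, ε * κ η * k η ≤ ε * k η := fun η hη => by
    have := mul_le_mul_of_nonneg_left (hκ1 η) (mul_nonneg hε0.le (hk0 η hη))
    linarith
  have hκC : ∀ η ∈ Metric.closedBall y R, ε * κ η * k η ≤ ε * C := fun η hη =>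
    (hκk η hη).trans (mul_le_mul_of_nonneg_left (hkC η hη) hε0.le)
  have hden : ∀ η ∈ Metric.closedBall y R, 0 < 1 - ε * κ η * k η := fun η hη => by
    linarith [hκC η hη]
  have hVsq : ∀ η ∈ Metric.closedBall y R, V η ^ 2 * (1 - s * t) ≤ k η ^ 2 := by
    intro η hη
    have h1 := hden η hη
    have h2 : 1 - s * t ≤ (1 - ε * κ η * k η) ^ 2 := by
      nlinarith [hκC η hη, sq_nonneg (ε * κ η * k η)]
    calc V η ^ 2 * (1 - s * t) ≤ V η ^ 2 * (1 - ε * κ η * k η) ^ 2 := by gcongr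
      _ = k η ^ 2 := by simp only [hV]; rw [div_pow, div_mul_cancel₀ _ (pow_pos h1 2).ne']
  have hVpos : ∀ η ∈ Metric.closedBall y R, η ≠ 0 → 0 < V η := fun η hη h0 =>
    div_pos (h.pos η (hR hη) h0) (hden η hη)
  have hVc : ContinuousOn V (Metric.closedBall y R) := by
    have hkc := h.continuousOn.mono hR
    refine hkc.div (continuousOn_const.sub ?_) fun η hη => (hden η hη).ne'
    exact (continuousOn_const.mul hκc.continuousOn).mul hkc
  have main := comparison hN h₀ h₁ hs ht hst one_le_two hKc hVc hVpos ?_ ?_ ?_ ?_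
  · have hκz := hκpos z (Metric.mem_ball.1 hz)
    refine ⟨ε * (κ z / 2), by positivity, ?_⟩
    filter_upwards [Metric.isOpen_ball.eventually_mem hz,
      hκc.continuousAt.eventually_const_lt (half_lt_self hκz)] with η h1 h2
    have hη := Metric.ball_subset_closedBall h1
    have h3 : ε * (κ z / 2) * k η ≤ ε * κ η * k η := by
      have := hk0 η hη
      gcongr
    have h4 := hden η hη
    refine ⟨hR hη, by linarith, ?_⟩
    rintro ξ₀ hξ₀ ξ₁ hξ₁ rfl
    refine le_trans ?_ (main ξ₀ hξ₀ ξ₁ hξ₁ hη)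
    have h5 := hk0 _ hη
    refine pow_le_pow_left₀ (div_nonneg h5 (by linarith)) ?_ 2
    exact div_le_div_of_nonneg_left h5 h4 (by linarith)
  · intro l hl
    set m := √(√l) with hm
    have hm4 : m ^ 4 = l := by
      rw [show m ^ 4 = (m ^ 2) ^ 2 by ring, hm, Real.sq_sqrt (by positivity),
        Real.sq_sqrt (by positivity)]
    have hm1 : 1 < m := by
      rw [hm, Real.lt_sqrt (by norm_num), Real.lt_sqrt (by norm_num)]
      simpa using hl
    have hm0 : 0 < m := by linarith
    have hkc : ContinuousAt k 0 := h.continuousOn.continuousAt (h.isOpen.mem_nhds h.zero_mem)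
    have hlim : Tendsto (fun η => ε * k η) (𝓝 0) (𝓝 0) := by
      simpa [h.map_zero] using (hkc.const_mul ε : ContinuousAt (fun η => ε * k η) 0).tendsto
    have hm2 : 0 < 1 - 1 / m := by
      rw [sub_pos, div_lt_one hm0]; exact hm1
    filter_upwards [h.pole m hm1, hlim.eventually_lt_const hm2] with η h1 h2 h3
    have h4 : 1 / m ≤ 1 - ε * κ η * k η := by linarith [hκk η h3]
    have h5 : V η ≤ m ^ 2 * ‖η‖ ^ N := by
      rw [hV, div_le_iff₀ (hden η h3)]
      calc k η ≤ m * ‖η‖ ^ N := h1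
        _ = m ^ 2 * ‖η‖ ^ N * (1 / m) := by field_simp
        _ ≤ _ := by gcongr
    calc V η ^ 2 ≤ (m ^ 2 * ‖η‖ ^ N) ^ 2 :=
          pow_le_pow_left₀ (div_nonneg (hk0 η h3) (hden η h3).le) h5 2
      _ = l * (‖η‖ ^ N) ^ 2 := by rw [← hm4]; ring
  · intro ξ hξ hξK
    have h1 := hVsq _ hξK
    have h2 := pow_le_pow_left₀ (hk0 _ hξK) (hray₀ ξ hξ) 2
    have h3 : V (s • ξ) ^ 2 * s ≤ V (s • ξ) ^ 2 * (1 - s * t) := by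
      gcongr
      nlinarith
    have h4 : s * V (s • ξ) ^ 2 ≤ s * (s * k₀ ξ ^ 2) := by linarith
    exact le_of_mul_le_mul_left h4 hs
  · intro ξ hξ hξK
    have h1 := hVsq _ hξK
    have h2 := pow_le_pow_left₀ (hk0 _ hξK) (hray₁ ξ hξ) 2
    have h3 : V (t • ξ) ^ 2 * t ≤ V (t • ξ) ^ 2 * (1 - s * t) := by
      gcongr
      nlinarith
    have h4 : t * V (t • ξ) ^ 2 ≤ t * (t * k₁ ξ ^ 2) := by linarith
    exact le_of_mul_le_mul_left h4 ht
  · intro η hη hη0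
    rcases lt_or_ge (dist η y) r with hlt | hge
    · left
      intro ξ₀ hξ₀ ξ₁ hξ₁ hη'
      obtain ⟨-, h1, h2⟩ := hball hlt
      refine le_trans ?_ (h2 ξ₀ hξ₀ ξ₁ hξ₁ hη')
      refine pow_le_pow_left₀ (hVpos η hη hη0).le ?_ 2
      refine div_le_div_of_nonneg_left (hk0 η hη) (by linarith) ?_
      have : ε * k η ≤ ε₀ * k η := mul_le_mul_of_nonneg_right (min_le_left _ _) (hk0 η hη)
      linarith [hκk η hη]
    rcases (Metric.mem_closedBall.1 hη).lt_or_eq with hlt | heq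
    · right
      obtain ⟨L, hL, hlap⟩ := hκlap η hge
      refine ⟨mem_of_superset (Metric.isOpen_ball.mem_nhds hlt) Metric.ball_subset_closedBall,
        0 + -ε * L, by nlinarith, ?_⟩
      refine ((h.harmonic η (hR hη) hη0).add (hlap.const_mul (-ε))).congr ?_
      filter_upwards [Metric.isOpen_ball.eventually_mem (Metric.mem_ball.2 hlt),
        isOpen_ne.eventually_mem hη0] with x h1 h2
      have := h.pos x (hR (Metric.ball_subset_closedBall h1)) h2
      simp only [hV, inv_div]
      field_simp
      ring
    · left
      rintro ξ₀ hξ₀ ξ₁ hξ₁ rfl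
      have h1 : V (s • ξ₀ + t • ξ₁) = k (s • ξ₀ + t • ξ₁) := by simp [hV, hκR _ heq]
      rw [h1]
      have h2 := le_add hN h h₀ h₁ hs ht hst hU hray₀ hray₁ ξ₀ hξ₀ ξ₁ hξ₁
      have h3 : (s * k₀ ξ₀ + t * k₁ ξ₁) ^ 2 ≤ s * k₀ ξ₀ ^ 2 + t * k₁ ξ₁ ^ 2 := by
        simpa using (convexOn_pow 2).2 (h₀.nonneg hξ₀) (h₁.nonneg hξ₁) hs.le ht.le hst
      exact (pow_le_pow_left₀ (hk0 _ hη) h2 2).trans h3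

end IsGauge

/-- Two functions with a common subgradient differ by a constant. -/
lemma sub_eq_sub_of_common_subgradient {f g σ : ℝ → ℝ}
    (hf : ∀ q > 0, ∀ q' > 0, f q - (q' - q) * σ q ≤ f q')
    (hg : ∀ q > 0, ∀ q' > 0, g q - (q' - q) * σ q ≤ g q') {q q' : ℝ} (hq : 0 < q)
    (hqq' : q < q') : f q - g q = f q' - g q' := by
  have key : ∀ (m : ℕ) (a b : ℝ), 0 < a → a < b →
      |(f b - g b) - (f a - g a)| ≤ (b - a) * (σ a - σ b) / 2 ^ m := by
    intro m
    induction m with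
    | zero =>
      intro a b ha hab
      have hb := ha.trans hab
      have h1 := hf a ha b hb
      have h2 := hf b hb a ha
      have h3 := hg a ha b hb
      have h4 := hg b hb a ha
      rw [pow_zero, div_one, abs_le]
      constructor <;> linarith
    | succ m ih =>
      intro a b ha hab
      have h1 := ih a ((a + b) / 2) ha (by linarith)
      have h2 := ih ((a + b) / 2) b (by linarith) (by linarith)
      have h3 := abs_add_le ((f b - g b) - (f ((a + b) / 2) - g ((a + b) / 2)))
        ((f ((a + b) / 2) - g ((a + b) / 2)) - (f a - g a))
      rw [sub_add_sub_cancel] at h3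
      refine h3.trans ((add_le_add h2 h1).trans_eq ?_)
      field_simp
      ring
  have hlim : Tendsto (fun m : ℕ => (q' - q) * (σ q - σ q') / 2 ^ m) atTop (𝓝 0) :=
    tendsto_const_nhds.div_atTop (tendsto_pow_atTop_atTop_of_one_lt one_lt_two)
  have h1 := ge_of_tendsto' hlim fun m => key m q q' hq hqq'
  have h2 := abs_nonpos_iff.1 h1
  linarith

namespace IsGauge

variable {N : ℕ} {U U₀ U₁ : Set (Rn (N + 2))} {k k₀ k₁ : Rn (N + 2) → ℝ} {s t : ℝ}

lemma exists_isMaxOn (h : IsGauge N U k) (v : Rn (N + 2)) {q : ℝ} (hq : 0 < q) :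
    ∃ η ∈ U, ∀ ζ ∈ U, inner ℝ v ζ - q * k ζ ≤ inner ℝ v η - q * k η := by
  obtain ⟨R, hR⟩ := h.isBounded.exists_norm_le
  have hR0 : 0 ≤ R := by simpa using hR 0 h.zero_mem
  have hbd : ∀ ζ ∈ U, inner ℝ v ζ ≤ ‖v‖ * R := fun ζ hζ =>
    (real_inner_le_norm v ζ).trans (by gcongr; exact hR ζ hζ)
  have h0 : (0 : Rn (N + 2)) ∈ {ζ ∈ U | k ζ ≤ ‖v‖ * R / q} :=
    ⟨h.zero_mem, by rw [h.map_zero]; positivity⟩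
  obtain ⟨η, hη, hmax⟩ := (h.isCompact (‖v‖ * R / q)).exists_isMaxOn ⟨0, h0⟩
    (f := fun ζ => inner ℝ v ζ - q * k ζ) (ContinuousOn.sub (by fun_prop)
      (continuousOn_const.mul (h.continuousOn.mono fun ζ hζ => hζ.1)))
  refine ⟨η, hη.1, fun ζ hζ => ?_⟩
  by_cases hk : k ζ ≤ ‖v‖ * R / q
  · exact hmax ⟨hζ, hk⟩
  · rw [le_div_iff₀ hq, not_le] at hk
    have h1 : inner ℝ v (0 : Rn (N + 2)) - q * k 0 ≤ inner ℝ v η - q * k η := hmax h0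
    rw [inner_zero_right, h.map_zero] at h1
    linarith [hbd ζ hζ]

/-- The maximal value of `⟪v, ·⟫ - q k` tends to `0` as `q → ∞`. -/
lemma exists_sub_le (h : IsGauge N U k) (v : Rn (N + 2)) {ε : ℝ} (hε : 0 < ε) :
    ∃ q₀ : ℝ, ∀ q > 0, q₀ ≤ q → ∀ ξ ∈ U, inner ℝ v ξ - q * k ξ ≤ ‖v‖ * ε := by
  obtain ⟨R, hR⟩ := h.isBounded.exists_norm_le
  have hR0 : 0 ≤ R := by simpa using hR 0 h.zero_mem
  refine ⟨‖v‖ * R / ε ^ N, fun q hq hq₀ ξ hξ => ?_⟩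
  rw [div_le_iff₀ (by positivity)] at hq₀
  have hk := h.norm_le ξ hξ
  have hk0 := mul_nonneg hq.le (h.nonneg hξ)
  rcases le_or_gt ‖ξ‖ ε with h1 | h1
  · have := (real_inner_le_norm v ξ).trans (mul_le_mul_of_nonneg_left h1 (norm_nonneg v))
    linarith
  · have h2 := (real_inner_le_norm v ξ).trans
      (mul_le_mul_of_nonneg_left (hR ξ hξ) (norm_nonneg v))
    have h3 : ε ^ N ≤ k ξ := (pow_le_pow_left₀ hε.le h1.le N).trans hk
    have h4 : 0 ≤ ‖v‖ * ε := by positivity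
    nlinarith

/-- If every point of `U` is a Minkowski combination of points of `U₀` and `U₁` at the same level,
then `U₁` cannot be a nontrivial translate of `U₀`. -/
lemma eq_zero_of_level_matching (h : IsGauge N U k) (h₀ : IsGauge N U₀ k₀)
    (h₁ : IsGauge N U₁ k₁) (hs : 0 < s) (ht : 0 < t)
    (hU : ∀ ξ₀ ∈ U₀, ∀ ξ₁ ∈ U₁, s • ξ₀ + t • ξ₁ ∈ U)
    (hle : ∀ ξ₀ ∈ U₀, ∀ ξ₁ ∈ U₁, k (s • ξ₀ + t • ξ₁) ≤ s * k₀ ξ₀ + t * k₁ ξ₁)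
    (hst : s + t = 1)
    (hmatch : ∀ η ∈ U, ∃ ξ₀ ∈ U₀, ∃ ξ₁ ∈ U₁, s • ξ₀ + t • ξ₁ = η ∧ k₀ ξ₀ = k η ∧ k₁ ξ₁ = k η)
    {v : Rn (N + 2)} (hv : ∀ ξ ∈ U₁, ξ + v ∈ U₀) : v = 0 := by
  have hmax : ∀ q : ℝ, ∃ a b, 0 < q → a ∈ U₀ ∧ b ∈ U₁ ∧ k₀ a = k₁ b ∧
      (∀ ζ ∈ U₀, inner ℝ v ζ - q * k₀ ζ ≤ inner ℝ v a - q * k₀ a) ∧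
      ∀ ζ ∈ U₁, inner ℝ v ζ - q * k₁ ζ ≤ inner ℝ v b - q * k₁ b := by
    intro q
    by_cases hq : 0 < q
    swap
    · exact ⟨0, 0, fun h => absurd h hq⟩
    obtain ⟨η, hη, hmax⟩ := h.exists_isMaxOn v hq
    obtain ⟨a, ha, b, hb, rfl, hka, hkb⟩ := hmatch η hη
    refine ⟨a, b, fun _ => ⟨ha, hb, hka.trans hkb.symm, fun ζ hζ => ?_, fun ζ hζ => ?_⟩⟩
    · have h1 := hmax _ (hU ζ hζ b hb)
      have h2 := mul_le_mul_of_nonneg_left (hle ζ hζ b hb) hq.le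
      simp only [inner_add_right, inner_smul_right] at h1
      rw [← hka] at h1
      rw [hkb, ← hka] at h2
      have h3 : s * (inner ℝ v ζ - q * k₀ ζ) ≤ s * (inner ℝ v a - q * k₀ a) := by
        obtain rfl : t = 1 - s := by linarith
        linarith
      exact le_of_mul_le_mul_left h3 hs
    · have h1 := hmax _ (hU a ha ζ hζ)
      have h2 := mul_le_mul_of_nonneg_left (hle a ha ζ hζ) hq.le
      simp only [inner_add_right, inner_smul_right] at h1
      rw [← hkb] at h1
      rw [hka, ← hkb] at h2
      have h3 : t * (inner ℝ v ζ - q * k₁ ζ) ≤ t * (inner ℝ v b - q * k₁ b) := by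
        obtain rfl : s = 1 - t := by linarith
        linarith
      exact le_of_mul_le_mul_left h3 ht
  choose a b hab using hmax
  have hsub := fun q q' : ℝ => sub_eq_sub_of_common_subgradient (q := q) (q' := q') (f := fun q => inner ℝ v (a q) - q * k₀ (a q))
    (g := fun q => inner ℝ v (b q) - q * k₁ (b q)) (σ := fun q => k₀ (a q))
    (fun q hq q' hq' => by
      have := (hab q' hq').2.2.2.1 (a q) (hab q hq).1
      linarith)
    (fun q hq q' hq' => by
      have := (hab q' hq').2.2.2.2 (b q) (hab q hq).2.1
      rw [(hab q hq).2.2.1]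
      linarith)
  have heq : ∀ q > 0, inner ℝ v (a q) = inner ℝ v (b q) := by
    intro q hq
    have hsmall : ∀ ε > 0, |inner ℝ v (a q) - inner ℝ v (b q)| ≤ ‖v‖ * ε := by
      intro ε hε
      obtain ⟨q₀, hq₀⟩ := exists_sub_le h₀ v hε
      obtain ⟨q₁, hq₁⟩ := exists_sub_le h₁ v hε
      obtain ⟨q', hqq', h1, h2⟩ : ∃ q', q < q' ∧ q₀ ≤ q' ∧ q₁ ≤ q' :=
        ⟨max (q + 1) (max q₀ q₁), by simp, by simp, by simp⟩
      have hq' := hq.trans hqq'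
      have h3 := hsub q q' hq hqq'
      obtain ⟨m1, m2, m3, m4, m5⟩ := hab q' hq'
      have h4 := hq₀ q' hq' h1 _ m1
      have h5 := hq₁ q' hq' h2 _ m2
      have h6 := m4 0 h₀.zero_mem
      have h7 := m5 0 h₁.zero_mem
      rw [inner_zero_right, h₀.map_zero] at h6
      rw [inner_zero_right, h₁.map_zero] at h7
      have h8 := (hab q hq).2.2.1
      rw [h8] at h3
      rw [abs_le]
      constructor <;> linarith
    have hlim : Tendsto (fun ε : ℝ => ‖v‖ * ε) (𝓝[>] 0) (𝓝 0) := by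
      have : ContinuousAt (fun ε : ℝ => ‖v‖ * ε) 0 := by fun_prop
      have h2 := this.tendsto
      rw [mul_zero] at h2
      exact h2.mono_left nhdsWithin_le_nhds
    have := ge_of_tendsto hlim (eventually_mem_nhdsWithin.mono fun ε hε => hsmall ε hε)
    linarith [abs_nonpos_iff.1 this]
  by_contra hv0
  have hv2 : 0 < ‖v‖ ^ 2 := by positivity
  obtain ⟨R, hR⟩ := h₀.isBounded.exists_norm_le
  have hbdd : BddAbove ((fun ζ => inner ℝ v ζ) '' U₀) := by
    refine ⟨‖v‖ * R, ?_⟩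
    rintro _ ⟨ζ, hζ, rfl⟩
    exact (real_inner_le_norm v ζ).trans (by gcongr; exact hR ζ hζ)
  have hne : ((fun ζ => inner ℝ v ζ) '' U₀).Nonempty := ⟨_, mem_image_of_mem _ h₀.zero_mem⟩
  obtain ⟨_, ⟨ζ, hζ, rfl⟩, hlt⟩ := exists_lt_of_lt_csSup hne
    (sub_lt_self (sSup ((fun ζ => inner ℝ v ζ) '' U₀)) hv2)
  simp only at hlt
  have hup : ∀ q > 0, inner ℝ v ζ - q * k₀ ζ ≤
      sSup ((fun ζ => inner ℝ v ζ) '' U₀) - ‖v‖ ^ 2 := by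
    intro q hq
    obtain ⟨m1, m2, m3, m4, m5⟩ := hab q hq
    have h1 := m4 ζ hζ
    have h2 := le_csSup hbdd (mem_image_of_mem _ (hv _ m2))
    simp only [inner_add_right, real_inner_self_eq_norm_sq] at h2
    have h3 := mul_nonneg hq.le (h₀.nonneg m1)
    rw [heq q hq] at h1
    linarith
  have hlim : Tendsto (fun q : ℝ => inner ℝ v ζ - q * k₀ ζ) (𝓝[>] 0) (𝓝 (inner ℝ v ζ)) := by
    have : ContinuousAt (fun q : ℝ => inner ℝ v ζ - q * k₀ ζ) 0 := by fun_prop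
    have h2 := this.tendsto
    rw [zero_mul, sub_zero] at h2
    exact h2.mono_left nhdsWithin_le_nhds
  have := le_of_tendsto hlim (eventually_mem_nhdsWithin.mono fun q hq => hup q hq)
  linarith

/-- Off the gain set, points are Minkowski combinations of points at the same level. -/
lemma level_matching_of_notMem_gainSet (h : IsGauge N U k) (h₀ : IsGauge N U₀ k₀)
    (h₁ : IsGauge N U₁ k₁) (hs : 0 < s) (ht : 0 < t) (hst : s + t = 1)
    (hle : ∀ ξ₀ ∈ U₀, ∀ ξ₁ ∈ U₁, k (s • ξ₀ + t • ξ₁) ≤ s * k₀ ξ₀ + t * k₁ ξ₁)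
    {η : Rn (N + 2)} (hη : η ∈ U) (hnot : η ∉ gainSet U U₀ U₁ k k₀ k₁ s t) :
    ∃ ξ₀ ∈ U₀, ∃ ξ₁ ∈ U₁, s • ξ₀ + t • ξ₁ = η ∧ k₀ ξ₀ = k η ∧ k₁ ξ₁ = k η := by
  set σ : Rn (N + 2) × Rn (N + 2) → Rn (N + 2) := fun p => s • p.1 + t • p.2 with hσ
  have hσc : Continuous σ := by fun_prop
  set ε : ℕ → ℝ := fun m => 1 / ((m : ℝ) + 1) * (1 / (2 * (k η + 1))) with hε
  have hkη := h.nonneg hη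
  have hε0 : ∀ m, 0 < ε m := fun m => by positivity
  have hε1 : ∀ m, ε m * (k η + 1) ≤ 1 / 2 := fun m => by
    have h1 : ε m * (k η + 1) = 1 / ((m : ℝ) + 1) * (1 / 2) := by simp only [hε]; field_simp
    have h2 : 1 / ((m : ℝ) + 1) ≤ 1 := by
      rw [div_le_one (by positivity)]
      linarith [(Nat.cast_nonneg m : (0 : ℝ) ≤ m)]
    linarith
  have hεlim : Tendsto ε atTop (𝓝 0) := by
    have := (tendsto_one_div_add_atTop_nhds_zero_nat (𝕜 := ℝ)).mul_const (1 / (2 * (k η + 1)))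
    rwa [zero_mul] at this
  have hkc : ContinuousAt k η := h.continuousOn.continuousAt (h.isOpen.mem_nhds hη)
  have hseq : ∀ m : ℕ, ∃ p : Rn (N + 2) × Rn (N + 2), p.1 ∈ U₀ ∧ p.2 ∈ U₁ ∧
      dist (σ p) η < 1 / ((m : ℝ) + 1) ∧ 0 ≤ k (σ p) ∧ k (σ p) < k η + 1 ∧
      s * k₀ p.1 ^ 2 + t * k₁ p.2 ^ 2 < (k (σ p) / (1 - ε m * k (σ p))) ^ 2 := by
    intro m
    have h1 : ∃ᶠ z in 𝓝 η, ¬ (z ∈ U ∧ ε m * k z < 1 ∧ ∀ ξ₀ ∈ U₀, ∀ ξ₁ ∈ U₁, s • ξ₀ + t • ξ₁ = z →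
        (k z / (1 - ε m * k z)) ^ 2 ≤ s * k₀ ξ₀ ^ 2 + t * k₁ ξ₁ ^ 2) :=
      not_eventually.1 fun h1 => hnot ⟨ε m, hε0 m, h1⟩
    have h2 : ∀ᶠ z in 𝓝 η, z ∈ U ∧ k z < k η + 1 ∧ dist z η < 1 / ((m : ℝ) + 1) := by
      filter_upwards [h.isOpen.eventually_mem hη, hkc.eventually_lt_const (lt_add_one (k η)),
        Metric.ball_mem_nhds η (show 0 < 1 / ((m : ℝ) + 1) by positivity)] with z h3 h4 h5
        using ⟨h3, h4, h5⟩
    obtain ⟨z, hz, hzU, hzk, hzd⟩ := (h1.and_eventually h2).exists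
    have hz1 : ε m * k z < 1 := by
      have := mul_le_mul_of_nonneg_left hzk.le (hε0 m).le
      linarith [hε1 m]
    have hz' : ¬ ∀ ξ₀ ∈ U₀, ∀ ξ₁ ∈ U₁, s • ξ₀ + t • ξ₁ = z →
        (k z / (1 - ε m * k z)) ^ 2 ≤ s * k₀ ξ₀ ^ 2 + t * k₁ ξ₁ ^ 2 :=
      fun h3 => hz ⟨hzU, hz1, h3⟩
    push Not at hz'
    obtain ⟨ξ₀, hξ₀, ξ₁, hξ₁, rfl, hlt⟩ := hz'
    exact ⟨(ξ₀, ξ₁), hξ₀, hξ₁, hzd, h.nonneg hzU, hzk, hlt⟩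
  choose p hp0 hp1 hpd hpk0 hpk hplt using hseq
  set C := (2 * (k η + 1)) ^ 2 with hC
  have hbound : ∀ m, s * k₀ (p m).1 ^ 2 + t * k₁ (p m).2 ^ 2 ≤ C := by
    intro m
    refine (hplt m).le.trans (pow_le_pow_left₀ (div_nonneg (hpk0 m) ?_) ?_ 2) <;>
    have h1 := mul_le_mul_of_nonneg_left (hpk m).le (hε0 m).le
    · linarith [hε1 m]
    · rw [div_le_iff₀ (by linarith [hε1 m])]
      nlinarith [hε1 m, hpk m]
  set B := C / s + C / t + 1 with hB
  have hB1 : ∀ x : ℝ, s * x ^ 2 ≤ C → x ≤ B := fun x hx => by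
    rw [← le_div_iff₀' hs] at hx
    have : 0 ≤ C / t := by positivity
    nlinarith [sq_nonneg (x - 1)]
  have hB2 : ∀ x : ℝ, t * x ^ 2 ≤ C → x ≤ B := fun x hx => by
    rw [← le_div_iff₀' ht] at hx
    have : 0 ≤ C / s := by positivity
    nlinarith [sq_nonneg (x - 1)]
  have hmem : ∀ m, p m ∈ {ξ ∈ U₀ | k₀ ξ ≤ B} ×ˢ {ξ ∈ U₁ | k₁ ξ ≤ B} := by
    intro m
    have h1 := hbound m
    have h2 : 0 ≤ s * k₀ (p m).1 ^ 2 := by positivity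
    have h3 : 0 ≤ t * k₁ (p m).2 ^ 2 := by positivity
    exact ⟨⟨hp0 m, hB1 _ (by linarith)⟩, hp1 m, hB2 _ (by linarith)⟩
  obtain ⟨x, hx, φ, hφ, hlim⟩ := ((h₀.isCompact B).prod (h₁.isCompact B)).tendsto_subseq hmem
  have hx0 : x.1 ∈ U₀ := hx.1.1
  have hx1 : x.2 ∈ U₁ := hx.2.1
  have hση : Tendsto (fun m => σ (p m)) atTop (𝓝 η) := by
    rw [tendsto_iff_dist_tendsto_zero]
    exact squeeze_zero (fun _ => dist_nonneg) (fun m => (hpd m).le)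
      tendsto_one_div_add_atTop_nhds_zero_nat
  have hση' := hση.comp hφ.tendsto_atTop
  have hσx : σ x = η := tendsto_nhds_unique ((hσc.tendsto x).comp hlim) hση'
  have hlim0 : Tendsto (fun m => k₀ (p (φ m)).1) atTop (𝓝 (k₀ x.1)) :=
    (h₀.continuousOn.continuousAt (h₀.isOpen.mem_nhds hx0)).tendsto.comp
      ((continuous_fst.tendsto x).comp hlim)
  have hlim1 : Tendsto (fun m => k₁ (p (φ m)).2) atTop (𝓝 (k₁ x.2)) :=
    (h₁.continuousOn.continuousAt (h₁.isOpen.mem_nhds hx1)).tendsto.comp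
      ((continuous_snd.tendsto x).comp hlim)
  have hlimk : Tendsto (fun m => k (σ (p (φ m)))) atTop (𝓝 (k η)) := hkc.tendsto.comp hση'
  have hlimr : Tendsto (fun m => (k (σ (p (φ m))) / (1 - ε (φ m) * k (σ (p (φ m))))) ^ 2) atTop
      (𝓝 ((k η / (1 - 0 * k η)) ^ 2)) :=
    (hlimk.div (tendsto_const_nhds.sub ((hεlim.comp hφ.tendsto_atTop).mul hlimk))
      (by simp)).pow 2
  have hfin := le_of_tendsto_of_tendsto' (((hlim0.pow 2).const_mul s).add
    ((hlim1.pow 2).const_mul t)) hlimr fun m => (hplt (φ m)).le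
  rw [zero_mul, sub_zero, div_one] at hfin
  have hle' := hle x.1 hx0 x.2 hx1
  change k (σ x) ≤ _ at hle'
  rw [hσx] at hle'
  have hk0 := h₀.nonneg hx0
  have hk1 := h₁.nonneg hx1
  have hsq : k η ^ 2 ≤ (s * k₀ x.1 + t * k₁ x.2) ^ 2 := pow_le_pow_left₀ hkη hle' 2
  obtain rfl : t = 1 - s := by linarith
  have hdiff : s * (1 - s) * (k₀ x.1 - k₁ x.2) ^ 2 ≤ 0 := by nlinarith
  have hsame : k₀ x.1 = k₁ x.2 := by
    have h1 : (k₀ x.1 - k₁ x.2) ^ 2 ≤ 0 := by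
      by_contra! h2
      have := mul_pos (mul_pos hs ht) h2
      linarith
    have := pow_eq_zero_iff two_ne_zero |>.1 (le_antisymm h1 (sq_nonneg _))
    linarith
  rw [hsame] at hfin hle'
  have h1 : k₁ x.2 ≤ k η := abs_le_of_sq_le_sq' (by linarith) hkη |>.2
  have h2 : k₁ x.2 = k η := le_antisymm h1 (by linarith)
  exact ⟨x.1, hx0, x.2, hx1, hσx, hsame.trans h2, h2⟩

/-- The squares of the gauges satisfy a convexity inequality with a definite gain at the pole. -/
lemma zero_mem_gainSet (hN : 1 ≤ N) (h : IsGauge N U k) (h₀ : IsGauge N U₀ k₀)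
    (h₁ : IsGauge N U₁ k₁) (hs : 0 < s) (ht : 0 < t) (hst : s + t = 1) (hUc : IsPreconnected U)
    (hU : ∀ ξ₀ ∈ U₀, ∀ ξ₁ ∈ U₁, s • ξ₀ + t • ξ₁ ∈ U)
    (hray₀ : ∀ ξ ∈ U₀, k (s • ξ) ≤ s * k₀ ξ) (hray₁ : ∀ ξ ∈ U₁, k (t • ξ) ≤ t * k₁ ξ)
    {v : Rn (N + 2)} (hv0 : v ≠ 0) (hv : ∀ ξ ∈ U₁, ξ + v ∈ U₀) :
    0 ∈ gainSet U U₀ U₁ k k₀ k₁ s t := by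
  refine subset_of_ball_spreading h.isOpen hUc (isOpen_gainSet ..) ?_
    (fun y hy R hR => ball_subset_gainSet hN h h₀ h₁ hs ht hst hU hray₀ hray₁ hy hR) h.zero_mem
  by_contra hempty
  have hle := le_add hN h h₀ h₁ hs ht hst hU hray₀ hray₁
  refine hv0 (eq_zero_of_level_matching h h₀ h₁ hs ht hU hle hst (fun η hη => ?_) hv)
  exact level_matching_of_notMem_gainSet h h₀ h₁ hs ht hst hle hη
    fun h1 => hempty ⟨η, hη, h1⟩

end IsGauge

/-- `g = ‖·‖ ^ (-N) - φ` is a Green function of `U` with pole `0`. -/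
structure IsPole (N : ℕ) (U : Set (Rn (N + 2))) (φ g : Rn (N + 2) → ℝ) : Prop where
  isOpen : IsOpen U
  isBounded : Bornology.IsBounded U
  isPreconnected : IsPreconnected U
  zero_mem : 0 ∈ U
  continuousOn : ContinuousOn φ U
  harmonic : ∀ ξ ∈ U, HasLap φ ξ 0
  eq : ∀ ξ ∈ U, ξ ≠ 0 → g ξ = (‖ξ‖ ^ N)⁻¹ - φ ξ
  continuousOn_green : ContinuousOn g (closure U \ {0})
  frontier : ∀ ξ ∈ frontier U, g ξ = 0

/-- The reciprocal of `‖·‖ ^ (-N) - φ`. -/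
def greenGauge {N : ℕ} (φ : Rn (N + 2) → ℝ) (ξ : Rn (N + 2)) : ℝ := ‖ξ‖ ^ N / (1 - ‖ξ‖ ^ N * φ ξ)

namespace IsPole

variable {N : ℕ} {U U₀ U₁ : Set (Rn (N + 2))} {φ g φ₀ g₀ φ₁ g₁ : Rn (N + 2) → ℝ} {s t : ℝ}

lemma exists_isCompact (h : IsPole N U φ g) {ε : ℝ} (hε : 0 < ε) :
    ∃ K ⊆ U, IsCompact K ∧ ∀ x ∈ U, x ∉ K → x ≠ 0 ∧ |g x| ≤ ε := by
  obtain ⟨r, hr, hball⟩ := Metric.nhds_basis_closedBall.mem_iff.1 (h.isOpen.mem_nhds h.zero_mem)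
  have hA : IsCompact (closure U \ Metric.ball 0 r) :=
    h.isBounded.isCompact_closure.diff Metric.isOpen_ball
  have hgc : ContinuousOn (fun x => |g x|) (closure U \ Metric.ball 0 r) := by
    refine (h.continuousOn_green.mono fun x hx => ⟨hx.1, ?_⟩).abs
    rintro rfl
    exact hx.2 (Metric.mem_ball_self hr)
  have hB : IsCompact ((closure U \ Metric.ball 0 r) ∩ (fun x => |g x|) ⁻¹' Ici ε) :=
    hA.of_isClosed_subset (hgc.preimage_isClosed_of_isClosed hA.isClosed isClosed_Ici)
      inter_subset_left
  refine ⟨Metric.closedBall 0 r ∪ ((closure U \ Metric.ball 0 r) ∩ (fun x => |g x|) ⁻¹' Ici ε),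
    union_subset hball ?_, (isCompact_closedBall _ _).union hB, ?_⟩
  · rintro x ⟨⟨hx, -⟩, hgx⟩
    by_contra hxU
    have h1 : g x = 0 := h.frontier x (by rw [h.isOpen.frontier_eq]; exact ⟨hx, hxU⟩)
    rw [mem_preimage, h1, abs_zero, mem_Ici] at hgx
    linarith
  · intro x hx hxK
    rw [mem_union, not_or] at hxK
    refine ⟨?_, ?_⟩
    · rintro rfl
      exact hxK.1 (Metric.mem_closedBall_self hr.le)
    · by_contra! hlt
      exact hxK.2 ⟨⟨subset_closure hx, fun hb => hxK.1 (Metric.ball_subset_closedBall hb)⟩, hlt.le⟩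

lemma nonneg (h : IsPole N U φ g) : ∀ ξ ∈ U, 0 ≤ φ ξ := by
  refine nonneg_of_superharmonic (by omega) h.isOpen h.isBounded h.continuousOn
    (fun x hx => ⟨0, le_rfl, h.harmonic x hx⟩) fun ε hε => ?_
  obtain ⟨K, hKU, hK, hKg⟩ := h.exists_isCompact hε
  refine ⟨K, hKU, hK, fun x hx hxK => ?_⟩
  obtain ⟨h1, h2⟩ := hKg x hx hxK
  have h3 := h.eq x hx h1
  have h4 : 0 ≤ (‖x‖ ^ N)⁻¹ := by positivity
  linarith [(abs_le.1 h2).2]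

lemma continuousOn_one_sub (h : IsPole N U φ g) :
    ContinuousOn (fun ξ => 1 - ‖ξ‖ ^ N * φ ξ) U :=
  continuousOn_const.sub ((by fun_prop : Continuous fun ξ : Rn (N + 2) => ‖ξ‖ ^ N).continuousOn.mul
    h.continuousOn)

lemma eventually_lt (hN : 1 ≤ N) (h : IsPole N U φ g) {a : ℝ} (ha : a < 1) :
    ∀ᶠ ξ in 𝓝 0, a < 1 - ‖ξ‖ ^ N * φ ξ := by
  refine (h.continuousOn_one_sub.continuousAt
    (h.isOpen.mem_nhds h.zero_mem)).eventually_const_lt ?_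
  change a < 1 - ‖(0 : Rn (N + 2))‖ ^ N * φ 0
  rwa [norm_zero, zero_pow (by omega), zero_mul, sub_zero]

lemma eq_div (h : IsPole N U φ g) {ξ : Rn (N + 2)} (hξ : ξ ∈ U) (h0 : ξ ≠ 0) :
    g ξ = (1 - ‖ξ‖ ^ N * φ ξ) / ‖ξ‖ ^ N := by
  rw [h.eq ξ hξ h0]
  field_simp

lemma harmonic_sub (h : IsPole N U φ g) {ξ : Rn (N + 2)} (hξ : ξ ∈ U) (h0 : ξ ≠ 0) :
    HasLap (fun y => (‖y‖ ^ N)⁻¹ - φ y) ξ 0 := by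
  have := (HasLap.inv_norm_pow h0).add ((h.harmonic ξ hξ).const_mul (-1))
  rw [mul_zero, add_zero] at this
  exact this.congr (Eventually.of_forall fun y => by ring)

lemma harmonic_green (h : IsPole N U φ g) {ξ : Rn (N + 2)} (hξ : ξ ∈ U) (h0 : ξ ≠ 0) :
    HasLap g ξ 0 := by
  refine (h.harmonic_sub hξ h0).congr ?_
  filter_upwards [h.isOpen.eventually_mem hξ, isOpen_ne.eventually_mem h0] with y h1 h2
    using h.eq y h1 h2

lemma green_nonneg (hN : 1 ≤ N) (h : IsPole N U φ g) : ∀ ξ ∈ U, ξ ≠ 0 → 0 ≤ g ξ := by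
  have hcU : ContinuousOn g (U \ {0}) :=
    h.continuousOn_green.mono fun x hx => ⟨subset_closure hx.1, hx.2⟩
  have := nonneg_of_superharmonic (by omega) (h.isOpen.sdiff isClosed_singleton)
    (h.isBounded.subset sdiff_subset) hcU (fun x hx => ⟨0, le_rfl, h.harmonic_green hx.1 hx.2⟩)
    fun ε hε => ?_
  · exact fun ξ hξ h0 => this ξ ⟨hξ, h0⟩
  obtain ⟨K, hKU, hK, hKg⟩ := h.exists_isCompact hε
  obtain ⟨ρ, hρ, hball⟩ := Metric.eventually_nhds_iff.1 (h.eventually_lt hN zero_lt_one)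
  refine ⟨K \ Metric.ball 0 ρ, fun x hx => ⟨hKU hx.1, ?_⟩, hK.diff Metric.isOpen_ball, ?_⟩
  · rintro rfl
    exact hx.2 (Metric.mem_ball_self hρ)
  · intro x hx hxK
    by_cases h1 : x ∈ K
    · have h2 : dist x 0 < ρ := by
        by_contra h3
        exact hxK ⟨h1, h3⟩
      have h4 : 0 ≤ g x := by
        rw [h.eq_div hx.1 hx.2]
        exact div_nonneg (hball h2).le (by positivity)
      linarith
    · exact (abs_le.1 (hKg x hx.1 h1).2).1

/-- Strict positivity of the Green function, by Hopf's argument. -/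
lemma one_sub_pos (hN : 1 ≤ N) (h : IsPole N U φ g) {ξ : Rn (N + 2)} (hξ : ξ ∈ U) :
    0 < 1 - ‖ξ‖ ^ N * φ ξ := by
  set w : Rn (N + 2) → ℝ := fun ξ => 1 - ‖ξ‖ ^ N * φ ξ with hw
  have hwc : ContinuousOn w U := h.continuousOn_one_sub
  have hw0 : 0 < w 0 := (h.eventually_lt hN zero_lt_one).self_of_nhds
  have hS : IsOpen (U ∩ w ⁻¹' Ioi 0) := hwc.isOpen_inter_preimage h.isOpen isOpen_Ioi
  refine (subset_of_ball_spreading h.isOpen h.isPreconnected hS ⟨0, h.zero_mem, h.zero_mem, hw0⟩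
    ?_ hξ).2
  intro y hy R hR z hz
  obtain ⟨r, hr, hball⟩ := Metric.nhds_basis_closedBall.mem_iff.1 (hS.mem_nhds hy)
  obtain ⟨κ, hκc, hκ1, hκ0, hκR, hκpos, hκlap⟩ := exists_barrier (R := R) y hr
  refine ⟨hR (Metric.ball_subset_closedBall hz), ?_⟩
  rcases le_or_gt (dist z y) r with hzr | hzr
  · exact (hball hzr).2
  by_cases hz0 : z = 0
  · rw [hz0]; exact hw0
  obtain ⟨x₀, hx₀, hmin⟩ := (isCompact_closedBall y r).exists_isMinOn
    ⟨y, Metric.mem_closedBall_self hr.le⟩ (hwc.mono fun x hx => (hball hx).1)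
  have hm : 0 < w x₀ := (hball hx₀).2
  obtain ⟨B, hB⟩ := h.isBounded.exists_norm_le
  have hB0 : 0 ≤ B := by simpa using hB 0 h.zero_mem
  set ε := min (w x₀ / (B ^ N + 1)) (1 / (2 * (B ^ N + 1))) with hε
  have hε0 : 0 < ε := lt_min (by positivity) (by positivity)
  have hε1 : ε * B ^ N ≤ w x₀ := by
    have := (le_div_iff₀ (by positivity)).1 (min_le_left _ _ : ε ≤ w x₀ / (B ^ N + 1))
    nlinarith
  have hε2 : ε * B ^ N ≤ 1 / 2 := by
    have := (le_div_iff₀ (by positivity)).1 (min_le_right _ _ : ε ≤ 1 / (2 * (B ^ N + 1)))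
    nlinarith
  obtain ⟨ρ, hρ, hballρ⟩ := Metric.eventually_nhds_iff.1 (h.eventually_lt hN one_half_lt_one)
  have hfle : ∀ x ∈ U, x ≠ 0 → ε * B ^ N ≤ w x → 0 ≤ g x + -ε * κ x := by
    intro x hx h0 hle
    have h1 : 0 < ‖x‖ ^ N := by positivity
    have h2 : ‖x‖ ^ N ≤ B ^ N := pow_le_pow_left₀ (norm_nonneg _) (hB x hx) N
    have h3 : ε ≤ g x := by
      rw [h.eq_div hx h0, le_div_iff₀ h1]
      exact (mul_le_mul_of_nonneg_left h2 hε0.le).trans hle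
    nlinarith [hκ1 x]
  set O := (Metric.ball y R \ Metric.closedBall y r) \ {0} with hO
  have hOU : O ⊆ U := fun x hx => hR (Metric.ball_subset_closedBall hx.1.1)
  have hgc : ContinuousOn (fun x => g x + -ε * κ x) (U \ {0}) :=
    (h.continuousOn_green.mono fun x hx => ⟨subset_closure hx.1, hx.2⟩).add (by fun_prop)
  have key := nonneg_of_superharmonic (by omega)
    ((Metric.isOpen_ball.sdiff Metric.isClosed_closedBall).sdiff isClosed_singleton)
    (h.isBounded.subset hOU) (hgc.mono fun x hx => ⟨hOU hx, hx.2⟩)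
    (fun x hx => by
      obtain ⟨L, hL, hlap⟩ := hκlap x (not_le.1 hx.1.2).le
      exact ⟨0 + -ε * L, by nlinarith, (h.harmonic_green (hOU hx) hx.2).add (hlap.const_mul _)⟩)
    (fun ε' hε' => by
      have hA : IsCompact (Metric.closedBall y R \ Metric.ball 0 ρ) :=
        (isCompact_closedBall y R).diff Metric.isOpen_ball
      have hAU : Metric.closedBall y R \ Metric.ball 0 ρ ⊆ U \ {0} := by
        rintro x ⟨h1, h2⟩
        refine ⟨hR h1, ?_⟩
        rintro rfl
        exact h2 (Metric.mem_ball_self hρ)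
      refine ⟨_, ?_, hA.of_isClosed_subset ((hgc.mono hAU).preimage_isClosed_of_isClosed
        hA.isClosed (isClosed_Iic (a := -ε'))) inter_subset_left, fun x hx hxK => ?_⟩
      · rintro x ⟨hxA, hxlt⟩
        rw [mem_preimage, mem_Iic] at hxlt
        obtain ⟨hxU, hx0⟩ := hAU hxA
        refine ⟨⟨?_, fun hxr => ?_⟩, hx0⟩
        · refine lt_of_le_of_ne (Metric.mem_closedBall.1 hxA.1) fun heq => ?_
          have := h.green_nonneg hN x hxU hx0
          rw [hκR x heq] at hxlt
          linarith
        · have := hfle x hxU hx0 (hε1.trans (hmin hxr))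
          linarith
      · by_contra! hlt
        refine hxK ⟨⟨Metric.ball_subset_closedBall hx.1.1, fun hxρ => ?_⟩, hlt.le⟩
        have := hfle x (hOU hx) hx.2 (hε2.trans (hballρ hxρ).le)
        linarith)
  have h1 := key z ⟨⟨hz, not_le.2 hzr⟩, hz0⟩
  have h2 := mul_pos hε0 (hκpos z hz)
  have h3 : 0 < g z := by linarith
  rw [h.eq_div (hR (Metric.ball_subset_closedBall hz)) hz0] at h3
  exact (div_pos_iff_of_pos_right (by positivity)).1 h3

lemma isGauge (hN : 1 ≤ N) (h : IsPole N U φ g) : IsGauge N U (greenGauge φ) where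
  isOpen := h.isOpen
  isBounded := h.isBounded
  zero_mem := h.zero_mem
  continuousOn := (by fun_prop : Continuous fun ξ : Rn (N + 2) => ‖ξ‖ ^ N).continuousOn.div
    h.continuousOn_one_sub fun ξ hξ => (h.one_sub_pos hN hξ).ne'
  map_zero := by rw [greenGauge, norm_zero, zero_pow (by omega), zero_div]
  pos ξ hξ h0 := div_pos (by positivity) (h.one_sub_pos hN hξ)
  isCompact C := by
    obtain ⟨K, hKU, hK, hKg⟩ := h.exists_isCompact (ε := 1 / (2 * max C 1)) (by positivity)
    have hc : ContinuousOn (greenGauge φ) U :=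
      (by fun_prop : Continuous fun ξ : Rn (N + 2) => ‖ξ‖ ^ N).continuousOn.div
        h.continuousOn_one_sub fun ξ hξ => (h.one_sub_pos hN hξ).ne'
    have heq : {ξ ∈ U | greenGauge φ ξ ≤ C} = K ∩ greenGauge φ ⁻¹' Iic C := by
      ext ξ
      refine ⟨fun ⟨hξ, hle⟩ => ⟨?_, hle⟩, fun ⟨hξ, hle⟩ => ⟨hKU hξ, hle⟩⟩
      by_contra hξK
      obtain ⟨h0, hg⟩ := hKg ξ hξ hξK
      have h1 := h.one_sub_pos hN hξ
      have h2 : 0 < ‖ξ‖ ^ N := by positivity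
      have h3 := (le_abs_self _).trans hg
      rw [h.eq_div hξ h0, div_le_div_iff₀ h2 (by positivity)] at h3
      rw [greenGauge, div_le_iff₀ h1] at hle
      have h4 : C * (1 - ‖ξ‖ ^ N * φ ξ) ≤ max C 1 * (1 - ‖ξ‖ ^ N * φ ξ) := by
        gcongr
        exact le_max_left _ _
      linarith
    rw [heq]
    exact hK.of_isClosed_subset ((hc.mono hKU).preimage_isClosed_of_isClosed hK.isClosed
      isClosed_Iic) inter_subset_left
  norm_le ξ hξ := by
    rw [greenGauge, le_div_iff₀ (h.one_sub_pos hN hξ)]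
    have h1 : 0 ≤ ‖ξ‖ ^ N := by positivity
    nlinarith [mul_nonneg h1 (mul_nonneg h1 (h.nonneg ξ hξ))]
  pole l hl := by
    filter_upwards [h.eventually_lt hN (inv_lt_one_of_one_lt₀ hl)] with ξ hξ
    have hl0 : 0 < l := by linarith
    have h1 : 0 < 1 - ‖ξ‖ ^ N * φ ξ := lt_trans (by positivity) hξ
    rw [greenGauge, div_le_iff₀ h1]
    calc ‖ξ‖ ^ N = l * ‖ξ‖ ^ N * l⁻¹ := by field_simp
      _ ≤ _ := by gcongr
  harmonic ξ hξ h0 := by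
    refine (h.harmonic_sub hξ h0).congr ?_
    filter_upwards [h.isOpen.eventually_mem hξ, isOpen_ne.eventually_mem h0] with y h1 h2
    rw [greenGauge, inv_div, ← h.eq_div h1 h2, h.eq y h1 h2]

lemma greenGauge_smul_le (hN : 1 ≤ N) (h : IsPole N U φ g) (h₁ : IsPole N U₁ φ₁ g₁) (ht : 0 < t)
    (ht1 : t ≤ 1) (hU : ∀ ξ ∈ U₁, t • ξ ∈ U) :
    ∀ ξ ∈ U₁, greenGauge φ (t • ξ) ≤ t * greenGauge φ₁ ξ := by
  have hnorm : ∀ ξ : Rn (N + 2), ‖t • ξ‖ ^ N = t ^ N * ‖ξ‖ ^ N := fun ξ => by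
    rw [norm_smul, Real.norm_of_nonneg ht.le, mul_pow]
  have key := nonneg_of_superharmonic (h := fun ξ => φ₁ ξ + -t ^ N * φ (t • ξ)) (by omega)
    h₁.isOpen h₁.isBounded (h₁.continuousOn.add (continuousOn_const.mul
      (h.continuousOn.comp (by fun_prop) hU)))
    (fun ξ hξ => ⟨_, by simp, (h₁.harmonic ξ hξ).add
      ((h.harmonic (t • ξ) (hU ξ hξ)).comp_smul.const_mul (-t ^ N))⟩)
    (fun ε hε => by
      obtain ⟨K, hKU, hK, hKg⟩ := h₁.exists_isCompact hε
      refine ⟨K, hKU, hK, fun ξ hξ hξK => ?_⟩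
      obtain ⟨h0, h1⟩ := hKg ξ hξ hξK
      have h2 : t • ξ ≠ 0 := smul_ne_zero ht.ne' h0
      have h3 := h.green_nonneg hN _ (hU ξ hξ) h2
      have h4 := h₁.eq ξ hξ h0
      rw [h.eq _ (hU ξ hξ) h2, hnorm] at h3
      have h5 := mul_nonneg (pow_nonneg ht.le N) h3
      have h6 : t ^ N * (t ^ N * ‖ξ‖ ^ N)⁻¹ = (‖ξ‖ ^ N)⁻¹ := by field_simp
      rw [mul_sub, h6] at h5
      linarith [(abs_le.1 h1).2])
  intro ξ hξ
  have h1 := key ξ hξ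
  have h2 := h₁.one_sub_pos hN hξ
  have h3 : 1 - ‖ξ‖ ^ N * φ₁ ξ ≤ 1 - ‖t • ξ‖ ^ N * φ (t • ξ) := by
    rw [hnorm]
    have := mul_nonneg (pow_nonneg (norm_nonneg ξ) N) h1
    linarith
  have h4 : t ^ N ≤ t := pow_le_of_le_one ht.le ht1 (by omega)
  calc greenGauge φ (t • ξ) ≤ ‖t • ξ‖ ^ N / (1 - ‖ξ‖ ^ N * φ₁ ξ) :=
        div_le_div_of_nonneg_left (by positivity) h2 h3
    _ = t ^ N * greenGauge φ₁ ξ := by rw [hnorm, greenGauge, mul_div_assoc]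
    _ ≤ t * greenGauge φ₁ ξ := by
      gcongr
      exact (h₁.isGauge hN).nonneg hξ

lemma one_add_two_mul_le {x : ℝ} (hx : x < 1) : 1 + 2 * x ≤ 1 / (1 - x) ^ 2 := by
  rw [le_div_iff₀ (pow_pos (by linarith) 2)]
  nlinarith [mul_nonneg (sq_nonneg x) (by linarith : (0 : ℝ) ≤ 3 - 2 * x)]

lemma one_div_le_one_add {x : ℝ} (hx : |x| < 1 / 2) :
    1 / (1 - x) ^ 2 ≤ 1 + 2 * x + 12 * x ^ 2 := by
  obtain ⟨h1, h2⟩ := abs_lt.1 hx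
  rw [div_le_iff₀ (pow_pos (by linarith) 2)]
  have h3 : 0 ≤ 9 - 22 * x + 12 * x ^ 2 := by nlinarith
  nlinarith [mul_nonneg (sq_nonneg x) h3]

/-- Comparison of the next order terms at the pole. -/
lemma lt_of_zero_mem_gainSet (hN : 1 ≤ N) (h : IsPole N U φ g) (h₀ : IsPole N U₀ φ₀ g₀)
    (h₁ : IsPole N U₁ φ₁ g₁) (hs : 0 < s) (ht : 0 < t) (hst : s + t = 1)
    (hgain : 0 ∈ gainSet U U₀ U₁ (greenGauge φ) (greenGauge φ₀) (greenGauge φ₁) s t) :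
    φ 0 < s * φ₀ 0 + t * φ₁ 0 := by
  obtain ⟨ε, hε, hev⟩ := hgain
  have hc : ContinuousAt φ 0 := h.continuousOn.continuousAt (h.isOpen.mem_nhds h.zero_mem)
  have hc₀ : ContinuousAt φ₀ 0 := h₀.continuousOn.continuousAt (h₀.isOpen.mem_nhds h₀.zero_mem)
  have hc₁ : ContinuousAt φ₁ 0 := h₁.continuousOn.continuousAt (h₁.isOpen.mem_nhds h₁.zero_mem)
  have hsmall : ∀ {f : Rn (N + 2) → ℝ}, ContinuousAt f 0 →
      ∀ᶠ η in 𝓝 0, |‖η‖ ^ N * f η| < 1 / 2 := by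
    intro f hf
    have h1 : ContinuousAt (fun η : Rn (N + 2) => |‖η‖ ^ N * f η|) 0 := by fun_prop
    refine h1.eventually_lt_const ?_
    change |‖(0 : Rn (N + 2))‖ ^ N * f 0| < 1 / 2
    rw [norm_zero, zero_pow (by omega), zero_mul, abs_zero]
    norm_num
  have hineq : ∀ᶠ η in 𝓝[≠] (0 : Rn (N + 2)), φ η + ε ≤
      s * φ₀ η + t * φ₁ η + 6 * ‖η‖ ^ N * (s * φ₀ η ^ 2 + t * φ₁ η ^ 2) := by
    rw [eventually_nhdsWithin_iff]
    filter_upwards [hev, hsmall hc₀, hsmall hc₁, h₀.isOpen.eventually_mem h₀.zero_mem,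
      h₁.isOpen.eventually_mem h₁.zero_mem] with η ⟨hη, h2, h3⟩ h4 h5 h6 h7 h0
    have h0' : η ≠ 0 := h0
    have hw := h.one_sub_pos hN hη
    have h8 := h3 η h6 η h7 (by rw [← add_smul, hst, one_smul])
    simp only [greenGauge] at h2 h8
    set τ := ‖η‖ ^ N with hτ
    have hτ0 : 0 < τ := by positivity
    rw [← mul_div_assoc, div_lt_one hw] at h2
    have h9 : τ / (1 - τ * φ η) / (1 - ε * (τ / (1 - τ * φ η))) = τ / (1 - τ * (φ η + ε)) := by
      rw [div_div, mul_sub, mul_one]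
      congr 1
      field_simp
      ring
    rw [h9, div_pow, div_pow, div_pow] at h8
    have h10 : 1 / (1 - τ * (φ η + ε)) ^ 2 ≤
        s * (1 / (1 - τ * φ₀ η) ^ 2) + t * (1 / (1 - τ * φ₁ η) ^ 2) := by
      have hτ2 : 0 < τ ^ 2 := by positivity
      refine le_of_mul_le_mul_left ?_ hτ2
      linear_combination h8
    have h11 := one_add_two_mul_le (x := τ * (φ η + ε)) (by linarith)
    have h12 := mul_le_mul_of_nonneg_left (one_div_le_one_add h4) hs.le
    have h13 := mul_le_mul_of_nonneg_left (one_div_le_one_add h5) ht.le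
    refine le_of_mul_le_mul_left ?_ (mul_pos two_pos hτ0)
    linear_combination h10 + h11 + h12 + h13 + hst
  have hlhs : Tendsto (fun η => φ η + ε) (𝓝[≠] 0) (𝓝 (φ 0 + ε)) :=
    (hc.tendsto.add_const ε).mono_left nhdsWithin_le_nhds
  have hrhs : Tendsto (fun η => s * φ₀ η + t * φ₁ η +
      6 * ‖η‖ ^ N * (s * φ₀ η ^ 2 + t * φ₁ η ^ 2)) (𝓝[≠] 0) (𝓝 (s * φ₀ 0 + t * φ₁ 0)) := by
    have h1 : ContinuousAt (fun η => s * φ₀ η + t * φ₁ η +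
      6 * ‖η‖ ^ N * (s * φ₀ η ^ 2 + t * φ₁ η ^ 2)) 0 := by fun_prop
    have h2 := h1.tendsto
    rw [norm_zero, zero_pow (by omega), mul_zero, zero_mul, add_zero] at h2
    exact h2.mono_left nhdsWithin_le_nhds
  have := le_of_tendsto_of_tendsto hlhs hrhs hineq
  linarith

end IsPole

lemma isPole_of_isGreenFunctionR {N : ℕ} {Ω : Set (Rn (N + 2))} (hΩopen : IsOpen Ω)
    (hΩconv : Convex ℝ Ω) (hΩbd : Bornology.IsBounded Ω) {c : ℝ} (hc : 0 < c) {x : Rn (N + 2)}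
    (hx : x ∈ Ω) {G ψ : Rn (N + 2) → ℝ} (hG : IsGreenFunctionR Ω x G)
    (hψG : ∀ ξ ∈ Ω, ξ ≠ x → G ξ = -(c / ‖x - ξ‖ ^ N) + ψ ξ)
    (hψ : ContDiffOn ℝ (⊤ : ℕ∞) ψ Ω) (hharm : ∀ ξ ∈ Ω, laplacianR ψ ξ = 0) :
    IsPole N ((fun ξ => x + ξ) ⁻¹' Ω) (fun ξ => c⁻¹ * ψ (x + ξ)) (fun ξ => -c⁻¹ * G (x + ξ)) := by
  have hfr : _root_.frontier ((fun ξ => x + ξ) ⁻¹' Ω) = (fun ξ => x + ξ) ⁻¹' _root_.frontier Ω :=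
    ((Homeomorph.addLeft x).preimage_frontier Ω).symm
  have hcl : closure ((fun ξ => x + ξ) ⁻¹' Ω) = (fun ξ => x + ξ) ⁻¹' closure Ω :=
    ((Homeomorph.addLeft x).preimage_closure Ω).symm
  constructor
  · exact hΩopen.preimage (by fun_prop)
  · obtain ⟨R, hR⟩ := hΩbd.exists_norm_le
    refine isBounded_iff_forall_norm_le.2 ⟨R + ‖x‖, fun ξ hξ => ?_⟩
    have := norm_sub_le (x + ξ) x
    rw [add_sub_cancel_left] at this
    linarith [hR _ hξ]
  · exact (hΩconv.translate_preimage_right x).isPreconnected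
  · simpa using hx
  · exact continuousOn_const.mul (hψ.continuousOn.comp (by fun_prop) fun ξ hξ => hξ)
  · intro ξ hξ
    have h1 : ContDiffAt ℝ 2 ψ (x + ξ) :=
      (hψ.contDiffAt (hΩopen.mem_nhds hξ)).of_le (WithTop.coe_le_coe.2 (le_top : (2 : ℕ∞) ≤ ⊤))
    have h2 := (HasLap.of_contDiffAt h1).comp_add.const_mul c⁻¹
    rwa [hharm _ hξ, mul_zero] at h2
  · intro ξ hξ h0
    rw [hψG (x + ξ) hξ (by simpa using h0)]
    have : x - (x + ξ) = -ξ := by abel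
    rw [this, norm_neg]
    field_simp
    ring
  · rw [hcl]
    refine continuousOn_const.mul (hG.1.comp (by fun_prop) ?_)
    rintro ξ ⟨h1, h2⟩
    exact ⟨h1, by simpa using h2⟩
  · intro ξ hξ
    rw [hfr] at hξ
    rw [hG.2.1 _ hξ, mul_zero]


/-- **Theorem 8.4** (Cardaliaguet–Tahraoui; special case).  Let `Ω ⊆ ℝⁿ`, `n ≥ 3`, be a
smoothly bounded convex domain, write its Green function as
`G(x,ξ) = -c_n/|x-ξ|^{n-2} + ψ(x,ξ)` with `ψ(x,·)` harmonic, `c_n` being the constant making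
`-c_n/|ξ|^{n-2}` the fundamental solution of the Laplacian in `ℝⁿ`.  Then the Robin function
`Λ(x) = ψ(x,x)` is strictly convex on `Ω`. -/
theorem robin_strictly_convex (n : ℕ) (hn : 3 ≤ n) (Ω : Set (Rn n))
    (hΩopen : IsOpen Ω) (hΩconv : Convex ℝ Ω) (hΩbd : Bornology.IsBounded Ω)
    (hΩne : Ω.Nonempty) (hΩconn : IsConnected Ω)
    (hsmooth : ∃ (r : Rn n → ℝ) (W : Set (Rn n)), IsOpen W ∧ closure Ω ⊆ W ∧
      ContDiffOn ℝ (⊤ : ℕ∞) r W ∧ Ω = {x ∈ W | r x < 0} ∧ ∀ x ∈ frontier Ω, fderiv ℝ r x ≠ 0)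
    (c : ℝ) (hc : 0 < c)
    (hfund : ∀ w : Rn n → ℝ, ContDiff ℝ (⊤ : ℕ∞) w → HasCompactSupport w →
      (∫ ξ, (-(c / ‖ξ‖ ^ (n - 2))) * laplacianR w ξ) = w 0)
    (G : Rn n → Rn n → ℝ) (hG : ∀ x ∈ Ω, IsGreenFunctionR Ω x (G x))
    (ψ : Rn n → Rn n → ℝ)
    (hψG : ∀ x ∈ Ω, ∀ ξ ∈ Ω, ξ ≠ x → G x ξ = -(c / ‖x - ξ‖ ^ (n - 2)) + ψ x ξ)
    (hψharm : ∀ x ∈ Ω, ContDiffOn ℝ (⊤ : ℕ∞) (ψ x) Ω ∧ ∀ ξ ∈ Ω, laplacianR (ψ x) ξ = 0) :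
    StrictConvexOn ℝ Ω (fun x => ψ x x) := by
  obtain ⟨N, rfl⟩ : ∃ N, n = N + 2 := ⟨n - 2, by omega⟩
  have hN : 1 ≤ N := by omega
  have hpole : ∀ x ∈ Ω, IsPole N ((fun ξ => x + ξ) ⁻¹' Ω) (fun ξ => c⁻¹ * ψ x (x + ξ))
      (fun ξ => -c⁻¹ * G x (x + ξ)) := fun x hx =>
    isPole_of_isGreenFunctionR hΩopen hΩconv hΩbd hc hx (hG x hx)
      (fun ξ hξ h => by simpa using hψG x hx ξ hξ h) (hψharm x hx).1 (hψharm x hx).2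
  refine ⟨hΩconv, fun x hx y hy hxy s t hs ht hst => ?_⟩
  have hz := hΩconv hx hy hs.le ht.le hst
  have h := hpole _ hz
  have h₀ := hpole x hx
  have h₁ := hpole y hy
  have hU : ∀ ξ₀ ∈ (fun ξ => x + ξ) ⁻¹' Ω, ∀ ξ₁ ∈ (fun ξ => y + ξ) ⁻¹' Ω,
      s • ξ₀ + t • ξ₁ ∈ (fun ξ => s • x + t • y + ξ) ⁻¹' Ω := by
    intro ξ₀ hξ₀ ξ₁ hξ₁
    have h2 := hΩconv hξ₀ hξ₁ hs.le ht.le hst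
    rw [mem_preimage]
    convert h2 using 1
    module
  have hray₀ := IsPole.greenGauge_smul_le hN h h₀ hs (by linarith)
    fun ξ hξ => by simpa using hU ξ hξ 0 h₁.zero_mem
  have hray₁ := IsPole.greenGauge_smul_le hN h h₁ ht (by linarith)
    fun ξ hξ => by simpa using hU 0 h₀.zero_mem ξ hξ
  have hgain := IsGauge.zero_mem_gainSet hN (h.isGauge hN) (h₀.isGauge hN) (h₁.isGauge hN)
    hs ht hst h.isPreconnected hU hray₀ hray₁ (sub_ne_zero.2 hxy.symm) fun ξ hξ => by
      rw [mem_preimage] at hξ ⊢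
      convert hξ using 1
      abel
  have hlt := IsPole.lt_of_zero_mem_gainSet hN h h₀ h₁ hs ht hst hgain
  simp only [add_zero] at hlt
  refine lt_of_mul_lt_mul_left ?_ (inv_pos.2 hc).le
  simp only [smul_eq_mul]
  linarith

end Berndtsson
end
end
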